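/- arXiv:0911.3210 — 2 statements merged into one kernel-verified Lean document; each statement's English description precedes it below -/
import Mathlib

section
/- Let Λ = diag(d₁,…,d_n) be a traceless real diagonal matrix with dᵢ > d_{p+j} for all 1 ≤ i ≤ p and 1 ≤ j ≤ q. Then the set of diagonal vectors { ((gΛg⁻¹)₁₁, …, (gΛg⁻¹)_nn) : g ∈ SU(p,q) } (these diagonal entries are real) equals Conv{ (d_{σ(1)},…,d_{σ(n)}) : σ a permutation of {1,…,n} preserving {1,…,p} and {p+1,…,n} } + C, the Minkowski sum of this convex hull with C. -/
open Matrix Polynomial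

noncomputable section

/-- The signature matrix `J = diag(1,…,1,−1,…,−1)` with `p` ones and `q` minus ones. -/
def Jmat (p q : ℕ) : Matrix (Fin (p + q)) (Fin (p + q)) ℂ :=
  Matrix.diagonal fun i => if (i : ℕ) < p then 1 else -1

/-- The group `SU(p,q)` of complex `(p+q)×(p+q)` matrices `g` with `det g = 1` and
`gᴴ J g = J`. -/
def SUpq (p q : ℕ) : Set (Matrix (Fin (p + q)) (Fin (p + q)) ℂ) :=
  { g | g.det = 1 ∧ g.conjTranspose * Jmat p q * g = Jmat p q }

/-- `x` is the ordered spectrum of `M`: the entries of `x` are non-increasing within the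
first `p` coordinates and within the last `q` coordinates, every entry of the first block
is strictly greater than every entry of the second block, and the eigenvalues of `M`
counted with multiplicity are exactly the entries of `x` (its characteristic polynomial is
`∏ i (X - x i)`). -/
def IsOrderedSpectrum (p q : ℕ) (M : Matrix (Fin (p + q)) (Fin (p + q)) ℂ)
    (x : Fin (p + q) → ℝ) : Prop :=
  (∀ i j : Fin (p + q), i ≤ j → ((j : ℕ) < p ∨ p ≤ (i : ℕ)) → x j ≤ x i) ∧
  (∀ i j : Fin (p + q), (i : ℕ) < p → p ≤ (j : ℕ) → x j < x i) ∧
  M.charpoly = ∏ i, (X - Polynomial.C ((x i : ℂ)))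

/-- The cone `C` of nonnegative linear combinations of the vectors `eᵢ − e_{p+j}`,
`1 ≤ i ≤ p`, `1 ≤ j ≤ q`. -/
def coneC (p q : ℕ) : Set (Fin (p + q) → ℝ) :=
  { v | ∃ t : Fin (p + q) → Fin (p + q) → ℝ, (∀ i j, 0 ≤ t i j) ∧
      ∀ k : Fin (p + q), v k =
        ∑ i : Fin (p + q), ∑ j : Fin (p + q),
          if (i : ℕ) < p ∧ p ≤ (j : ℕ) then
            t i j * ((if k = i then 1 else 0) - (if k = j then 1 else 0))
          else 0 }

section Majorization

variable {n : ℕ} {S : Set (Fin n → ℝ)}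

/-- `S` is stable under transfers from a larger coordinate to a smaller one, as long as the
amount transferred does not exceed the gap between them. -/
def TransferClosed {ι : Type*} [DecidableEq ι] (S : Set (ι → ℝ)) : Prop :=
  ∀ x ∈ S, ∀ k l δ, 0 ≤ δ → x k + δ ≤ x l →
    x + δ • (Pi.single k (1 : ℝ) - Pi.single l (1 : ℝ)) ∈ S

lemma TransferClosed.comp_swap_mem {ι : Type*} [DecidableEq ι] {S : Set (ι → ℝ)}
    (hS : TransferClosed S) {x : ι → ℝ} (hx : x ∈ S) (k l : ι) : x ∘ Equiv.swap k l ∈ S := by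
  wlog h : x k ≤ x l generalizing k l
  · rw [Equiv.swap_comm]
    exact this l k (le_of_not_ge h)
  convert hS x hx k l (x l - x k) (sub_nonneg.2 h) (by linarith) using 1
  ext i
  by_cases hk : i = k <;> by_cases hl : i = l <;>
    simp [hk, hl, Equiv.swap_apply_def, Pi.single_apply] <;> grind

lemma TransferClosed.comp_perm_mem {ι : Type*} [DecidableEq ι] [Finite ι] {S : Set (ι → ℝ)}
    (hS : TransferClosed S) {x : ι → ℝ} (hx : x ∈ S) (σ : Equiv.Perm ι) : x ∘ σ ∈ S := by
  induction σ using Equiv.Perm.swap_induction_on' with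
  | one => simpa using hx
  | mul_swap f k l _ ih => exact hS.comp_swap_mem ih k l

/-- A vector with monotone entries whose partial sums dominate those of some `x ∈ S`, with equal
total, belongs to `S`. -/
lemma TransferClosed.mem_of_sum_le (hS : TransferClosed S) {y : Fin n → ℝ} (hy : Monotone y)
    {x : Fin n → ℝ} (hx : x ∈ S)
    (hle : ∀ m, ∑ i ∈ Finset.Iic m, x i ≤ ∑ i ∈ Finset.Iic m, y i)
    (hsum : ∑ i, x i = ∑ i, y i) : y ∈ S := by
  induction hN : (Finset.univ.filter fun i => x i ≠ y i).card using Nat.strong_induction_on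
    generalizing x with
  | _ N ih =>
  by_cases hxy : x = y
  · exact hxy ▸ hx
  have hex : ∃ l, y l < x l := by
    by_contra! h
    refine hxy (funext fun i => ?_)
    exact (Finset.sum_eq_sum_iff_of_le fun i _ => h i).1 hsum i (Finset.mem_univ i)
  obtain ⟨l, hl, hmin⟩ : ∃ l, y l < x l ∧ ∀ i < l, x i ≤ y i := by
    obtain ⟨l, hl, hm⟩ := Finset.exists_minimal (s := Finset.univ.filter fun i => y i < x i)
      (by simpa [Finset.Nonempty] using hex)
    refine ⟨l, by simpa using hl, fun i hi => ?_⟩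
    by_contra! h
    exact absurd (hm (by simpa using h) hi.le) (not_le.2 hi)
  obtain ⟨k, hkl, hk⟩ : ∃ k < l, x k < y k := by
    by_contra! h
    refine absurd (hle l) (not_le.2 ?_)
    refine Finset.sum_lt_sum (fun i hi => ?_) ⟨l, by simp, hl⟩
    rcases (Finset.mem_Iic.1 hi).lt_or_eq with h' | rfl
    · exact h i h'
    · exact hl.le
  set δ := min (y k - x k) (x l - y l) with hδ
  have hδ0 : 0 < δ := lt_min (by linarith) (by linarith)
  have hδk : δ ≤ y k - x k := min_le_left _ _
  have hδl : δ ≤ x l - y l := min_le_right _ _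
  have hykl := hy hkl.le
  set x' := x + δ • (Pi.single k (1 : ℝ) - Pi.single l (1 : ℝ)) with hx'
  have hx'S : x' ∈ S := hS x hx k l δ hδ0.le (by linarith)
  have hx'i : ∀ i, x' i = x i + δ * ((if i = k then 1 else 0) - (if i = l then 1 else 0)) := by
    intro i; simp [hx', Pi.single_apply]
  have hpart : ∀ s : Finset (Fin n), ∑ i ∈ s, x' i
      = ∑ i ∈ s, x i + δ * ((if k ∈ s then 1 else 0) - (if l ∈ s then 1 else 0)) := by
    intro s
    simp only [hx'i, Finset.sum_add_distrib, ← Finset.mul_sum, Finset.sum_sub_distrib,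
      Finset.sum_ite_eq']
  refine ih _ ?_ hx'S (fun m => ?_) (by simp [hpart, hsum]) rfl
  · rw [← hN]
    refine Finset.card_lt_card (Finset.ssubset_iff_subset_ne.2 ⟨fun i hi => ?_, fun h => ?_⟩)
    · simp only [Finset.mem_filter, Finset.mem_univ, true_and] at hi ⊢
      intro h
      apply hi
      rw [hx'i, h]
      have hik : i ≠ k := by rintro rfl; linarith
      have hil : i ≠ l := by rintro rfl; linarith
      simp [hik, hil]
    · have h1 := Finset.ext_iff.1 h k
      have h2 := Finset.ext_iff.1 h l
      simp only [Finset.mem_filter, Finset.mem_univ, true_and, hx'i, hkl.ne, hkl.ne',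
        if_true, if_false] at h1 h2
      rcases min_choice (y k - x k) (x l - y l) with h' | h'
      · exact h1.2 hk.ne (by rw [hδ, h']; ring)
      · exact h2.2 hl.ne' (by rw [hδ, h']; ring)
  · rw [hpart]
    by_cases hlm : l ≤ m
    · simpa [hlm, hkl.le.trans hlm] using hle m
    by_cases hkm : k ≤ m
    · have : δ ≤ ∑ i ∈ Finset.Iic m, (y i - x i) := by
        refine hδk.trans (Finset.single_le_sum (f := fun i => y i - x i) (fun i hi => ?_)
          (Finset.mem_Iic.2 hkm))
        exact sub_nonneg.2 (hmin i ((Finset.mem_Iic.1 hi).trans_lt (not_le.1 hlm)))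
      rw [Finset.sum_sub_distrib] at this
      simp only [Finset.mem_Iic, hkm, hlm, if_true, if_false]
      linarith
    · simpa [hlm, hkm] using hle m

lemma sum_Iic_le_sum_comp_perm {x : Fin n → ℝ} (hx : Monotone x) (σ : Equiv.Perm (Fin n))
    (m : Fin n) : ∑ i ∈ Finset.Iic m, x i ≤ ∑ i ∈ Finset.Iic m, x (σ i) := by
  have hanti : Antivary (fun i : Fin n => if i ≤ m then (1 : ℝ) else 0) x := by
    intro i j hij
    have : i < j := by
      by_contra! h
      exact absurd (hx h) (not_le.2 hij)
    by_cases hj : j ≤ m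
    · simp [hj, this.le.trans hj]
    · simp only [hj, if_false]
      split_ifs <;> norm_num
  have := hanti.sum_mul_le_sum_mul_comp_perm (σ := σ)
  simpa [ite_mul, Finset.sum_ite, Finset.filter_ge_eq_Iic] using this

/-- A transfer-closed set contains, with each of its elements `x`, the convex hull of all
rearrangements of `x`. -/
lemma TransferClosed.mem_of_mem_convexHull (hS : TransferClosed S) {x y : Fin n → ℝ} (hx : x ∈ S)
    (hy : y ∈ convexHull ℝ (Set.range fun σ : Equiv.Perm (Fin n) => x ∘ σ)) : y ∈ S := by
  set x₀ := x ∘ Tuple.sort x with hx₀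
  have hmono : Monotone x₀ := Tuple.monotone_sort x
  have key : y ∈ {z : Fin n → ℝ | (∀ (τ : Equiv.Perm (Fin n)) (m : Fin n),
      ∑ i ∈ Finset.Iic m, x₀ i ≤ ∑ i ∈ Finset.Iic m, z (τ i)) ∧ ∑ i, x₀ i = ∑ i, z i} := by
    refine convexHull_min ?_ ?_ hy
    · rintro _ ⟨σ, rfl⟩
      refine ⟨fun τ m => ?_, ?_⟩
      · refine (sum_Iic_le_sum_comp_perm hmono (τ.trans (σ.trans (Tuple.sort x).symm)) m).trans_eq ?_
        simp [hx₀]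
      · exact (Equiv.sum_comp (Tuple.sort x) x).trans (Equiv.sum_comp σ x).symm
    · intro z hz w hw a b ha hb hab
      refine ⟨fun τ m => ?_, ?_⟩
      · simp only [Pi.add_apply, Pi.smul_apply, smul_eq_mul, Finset.sum_add_distrib,
          ← Finset.mul_sum]
        calc _ = a * ∑ i ∈ Finset.Iic m, x₀ i + b * ∑ i ∈ Finset.Iic m, x₀ i := by
              rw [← add_mul, hab, one_mul]
          _ ≤ _ := add_le_add (mul_le_mul_of_nonneg_left (hz.1 τ m) ha)
              (mul_le_mul_of_nonneg_left (hw.1 τ m) hb)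
      · simp only [Pi.add_apply, Pi.smul_apply, smul_eq_mul, Finset.sum_add_distrib,
          ← Finset.mul_sum]
        rw [← hz.2, ← hw.2, ← add_mul, hab, one_mul]
  have hys : y ∘ Tuple.sort y ∈ S :=
    hS.mem_of_sum_le (Tuple.monotone_sort y) (hS.comp_perm_mem hx _) (key.1 _)
      (key.2.trans (Equiv.sum_comp (Tuple.sort y) y).symm)
  simpa [Function.comp_assoc] using hS.comp_perm_mem hys (Tuple.sort y).symm

end Majorization

section DiagonalEntries

variable {ι κ : Type*} [Fintype κ] [DecidableEq κ]

lemma mul_diagonal_mul_conjTranspose_apply_self (M : Matrix ι κ ℂ) (w : κ → ℝ) (i : ι) :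
    (M * diagonal (fun j => (w j : ℂ)) * Mᴴ) i i =
      ((∑ j, Complex.normSq (M i j) * w j : ℝ) : ℂ) := by
  rw [mul_apply]
  simp only [mul_diagonal, conjTranspose_apply, Complex.ofReal_sum, Complex.ofReal_mul,
    Complex.normSq_eq_conj_mul_self, RCLike.star_def]
  exact Finset.sum_congr rfl fun j _ => by ring

lemma mul_conjTranspose_apply_self (M : Matrix ι κ ℂ) (i : ι) :
    (M * Mᴴ) i i = ((∑ j, Complex.normSq (M i j) : ℝ) : ℂ) := by
  simpa using mul_diagonal_mul_conjTranspose_apply_self M (fun _ => 1) i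

lemma normSq_mem_doublyStochastic {W : Matrix κ κ ℂ} (hW : W ∈ unitaryGroup κ ℂ) :
    (of fun i j => Complex.normSq (W i j)) ∈ doublyStochastic ℝ κ := by
  refine mem_doublyStochastic_iff_sum.2 ⟨fun i j => Complex.normSq_nonneg _, fun i => ?_,
    fun j => ?_⟩
  · have h := mul_conjTranspose_apply_self W i
    rw [← star_eq_conjTranspose, mem_unitaryGroup_iff.1 hW, one_apply_eq] at h
    exact_mod_cast h.symm
  · have h := mul_conjTranspose_apply_self Wᴴ j
    rw [conjTranspose_conjTranspose, ← star_eq_conjTranspose, mem_unitaryGroup_iff'.1 hW,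
      one_apply_eq] at h
    simp only [star_apply, RCLike.star_def, Complex.normSq_conj] at h
    exact_mod_cast h.symm

/-- `X Xᴴ` and `Xᴴ X` are unitarily conjugate. -/
lemma exists_unitary_mul_conjTranspose_eq (X : Matrix κ κ ℂ) :
    ∃ W ∈ unitaryGroup κ ℂ, X * Xᴴ = W * (Xᴴ * X) * Wᴴ := by
  have h1 : (X * Xᴴ).IsHermitian := isHermitian_mul_conjTranspose_self X
  have h2 : (Xᴴ * X).IsHermitian := isHermitian_conjTranspose_mul_self X
  have he : h1.eigenvalues = h2.eigenvalues :=
    (IsHermitian.eigenvalues_eq_eigenvalues_iff h1 h2).2 (charpoly_mul_comm _ _)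
  obtain ⟨U, hU, e1⟩ : ∃ U ∈ unitaryGroup κ ℂ,
      X * Xᴴ = U * diagonal (RCLike.ofReal ∘ h1.eigenvalues) * Uᴴ :=
    ⟨h1.eigenvectorUnitary, SetLike.coe_mem _, h1.spectral_theorem⟩
  obtain ⟨V, hV, e2⟩ : ∃ V ∈ unitaryGroup κ ℂ,
      Xᴴ * X = V * diagonal (RCLike.ofReal ∘ h2.eigenvalues) * Vᴴ :=
    ⟨h2.eigenvectorUnitary, SetLike.coe_mem _, h2.spectral_theorem⟩
  rw [he] at e1
  generalize h2.eigenvalues = E at e1 e2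
  refine ⟨U * Vᴴ, mul_mem hU (Unitary.star_mem hV), ?_⟩
  have hVN : ∀ N, Vᴴ * (V * N) = N := fun N => by
    rw [← Matrix.mul_assoc, ← star_eq_conjTranspose, mem_unitaryGroup_iff'.1 hV, Matrix.one_mul]
  rw [e1, e2]
  simp only [conjTranspose_mul, conjTranspose_conjTranspose, Matrix.mul_assoc, hVN]

/-- If `Aᴴ A = 1 + Bᴴ B`, the diagonal of `A diag(w) Aᴴ` dominates that of a unitary conjugate of
`diag(w)`. -/
lemma exists_doublyStochastic_mulVec_le [Fintype ι] (A : Matrix κ κ ℂ) (B : Matrix ι κ ℂ)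
    (h : Aᴴ * A = 1 + Bᴴ * B) {w : κ → ℝ} (hw : ∀ i, 0 ≤ w i) :
    ∃ P ∈ doublyStochastic ℝ κ, ∀ i, (P *ᵥ w) i ≤ ∑ j, Complex.normSq (A i j) * w j := by
  classical
  set D : Matrix κ κ ℂ := diagonal fun i => ((√(w i) : ℝ) : ℂ) with hD
  have hDH : Dᴴ = D := by
    rw [hD, diagonal_conjTranspose]
    congr 1
    ext i
    simp
  have hDD : D * D = diagonal fun i => (w i : ℂ) := by
    rw [hD, diagonal_mul_diagonal]
    congr 1
    ext i
    rw [← Complex.ofReal_mul, Real.mul_self_sqrt (hw i)]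
  obtain ⟨W, hW, hXW⟩ := exists_unitary_mul_conjTranspose_eq (A * D)
  refine ⟨_, normSq_mem_doublyStochastic hW, fun i => ?_⟩
  have e1 : A * D * (A * D)ᴴ = A * diagonal (fun i => (w i : ℂ)) * Aᴴ := by
    rw [conjTranspose_mul, hDH, ← hDD]
    simp only [Matrix.mul_assoc]
  have e2 : W * ((A * D)ᴴ * (A * D)) * Wᴴ =
      W * diagonal (fun i => (w i : ℂ)) * Wᴴ + (W * D * Bᴴ) * (W * D * Bᴴ)ᴴ := by
    have : (A * D)ᴴ * (A * D) = D * D + D * (Bᴴ * B) * D := by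
      rw [conjTranspose_mul, hDH, Matrix.mul_assoc, ← Matrix.mul_assoc Aᴴ, h]
      simp only [Matrix.add_mul, Matrix.mul_add, Matrix.mul_assoc, Matrix.one_mul]
    rw [this, hDD]
    simp only [conjTranspose_mul, hDH, conjTranspose_conjTranspose, Matrix.mul_add, Matrix.add_mul,
      Matrix.mul_assoc]
  rw [e1, e2] at hXW
  have := congrFun (congrFun hXW i) i
  rw [Matrix.add_apply, mul_diagonal_mul_conjTranspose_apply_self,
    mul_diagonal_mul_conjTranspose_apply_self, mul_conjTranspose_apply_self] at this
  have h' : ∑ j, Complex.normSq (A i j) * w j = ∑ j, Complex.normSq (W i j) * w j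
      + ∑ j, Complex.normSq ((W * D * Bᴴ) i j) := by exact_mod_cast this
  rw [h']
  exact le_add_of_nonneg_right (Finset.sum_nonneg fun _ _ => Complex.normSq_nonneg _)

/-- Birkhoff: doubly stochastic images of a vector lie in the convex hull of its
rearrangements. -/
lemma mulVec_mem_convexHull_perm {P : Matrix κ κ ℝ} (hP : P ∈ doublyStochastic ℝ κ) (w : κ → ℝ) :
    P *ᵥ w ∈ convexHull ℝ (Set.range fun σ : Equiv.Perm κ => w ∘ σ) := by
  obtain ⟨c, hc, hc1, rfl⟩ := exists_eq_sum_perm_of_mem_doublyStochastic hP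
  rw [sum_mulVec]
  simp_rw [smul_mulVec]
  refine (convex_convexHull ℝ _).sum_mem (fun σ _ => hc σ) hc1 fun σ _ =>
    subset_convexHull ℝ _ ⟨σ, ?_⟩
  ext i
  simp [PEquiv.toMatrix_toPEquiv_mulVec]

end DiagonalEntries

section Orbit

variable {p q : ℕ}

/-- The diagonal entries of `J`, as real numbers. -/
def blockSign (p q : ℕ) (i : Fin (p + q)) : ℝ := if (i : ℕ) < p then 1 else -1

@[simp] lemma blockSign_castAdd (i : Fin p) : blockSign p q (Fin.castAdd q i) = 1 := by
  simp [blockSign]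

@[simp] lemma blockSign_natAdd (i : Fin q) : blockSign p q (Fin.natAdd p i) = -1 := by
  simp [blockSign]

lemma blockSign_mul_self (i : Fin (p + q)) : blockSign p q i * blockSign p q i = 1 := by
  unfold blockSign; split_ifs <;> norm_num

lemma Jmat_eq : Jmat p q = diagonal fun i => (blockSign p q i : ℂ) := by
  unfold Jmat blockSign
  congr 1
  ext i
  split_ifs <;> simp

lemma Jmat_mul_self : Jmat p q * Jmat p q = 1 := by
  rw [Jmat_eq, diagonal_mul_diagonal, ← diagonal_one]
  congr 1
  ext i
  exact_mod_cast blockSign_mul_self i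

lemma mul_Jmat_mul_conjTranspose_iff (g : Matrix (Fin (p + q)) (Fin (p + q)) ℂ) :
    g * Jmat p q * gᴴ = Jmat p q ↔ gᴴ * Jmat p q * g = Jmat p q := by
  have hJ : Jmat p q * Jmat p q = 1 := Jmat_mul_self
  constructor <;> intro h
  · have h1 : (g * (Jmat p q * gᴴ * Jmat p q)) = 1 := by
      rw [← Matrix.mul_assoc, ← Matrix.mul_assoc, h, hJ]
    rw [mul_eq_one_comm] at h1
    calc gᴴ * Jmat p q * g = Jmat p q * Jmat p q * (gᴴ * Jmat p q * g) := by
          rw [hJ, Matrix.one_mul]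
      _ = Jmat p q * ((Jmat p q * gᴴ * Jmat p q) * g) := by simp only [Matrix.mul_assoc]
      _ = _ := by rw [h1, Matrix.mul_one]
  · have h1 : ((Jmat p q * gᴴ * Jmat p q) * g) = 1 := by
      rw [Matrix.mul_assoc, Matrix.mul_assoc, ← Matrix.mul_assoc gᴴ, h, hJ]
    rw [mul_eq_one_comm] at h1
    calc g * Jmat p q * gᴴ = g * Jmat p q * gᴴ * (Jmat p q * Jmat p q) := by
          rw [hJ, Matrix.mul_one]
      _ = (g * (Jmat p q * gᴴ * Jmat p q)) * Jmat p q := by simp only [Matrix.mul_assoc]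
      _ = _ := by rw [h1, Matrix.one_mul]

/-- The diagonal vectors of `g diag(d) g⁻¹` for `g` in `U(p,q)`. -/
def diagonalImage (p q : ℕ) (d : Fin (p + q) → ℝ) : Set (Fin (p + q) → ℝ) :=
  { v | ∃ g : Matrix (Fin (p + q)) (Fin (p + q)) ℂ, g * Jmat p q * gᴴ = Jmat p q ∧
    ∀ k, v k = blockSign p q k * ∑ m, Complex.normSq (g k m) * (blockSign p q m * d m) }

lemma conj_diagonal_apply_self {g : Matrix (Fin (p + q)) (Fin (p + q)) ℂ}
    (hg : gᴴ * Jmat p q * g = Jmat p q) (d : Fin (p + q) → ℝ) (k : Fin (p + q)) :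
    (g * diagonal (fun i => (d i : ℂ)) * g⁻¹) k k =
      ((blockSign p q k * ∑ m, Complex.normSq (g k m) * (blockSign p q m * d m) : ℝ) : ℂ) := by
  have hinv : g⁻¹ = Jmat p q * gᴴ * Jmat p q := by
    refine inv_eq_left_inv ?_
    rw [Matrix.mul_assoc, Matrix.mul_assoc, ← Matrix.mul_assoc gᴴ, hg, Jmat_mul_self]
  have : g * diagonal (fun i => (d i : ℂ)) * g⁻¹ =
      g * diagonal (fun i => ((blockSign p q i * d i : ℝ) : ℂ)) * gᴴ * Jmat p q := by
    have h : diagonal (fun i => (d i : ℂ)) * Jmat p q =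
        diagonal (fun i => ((blockSign p q i * d i : ℝ) : ℂ)) := by
      rw [Jmat_eq, diagonal_mul_diagonal]
      congr 1
      ext i
      push_cast
      ring
    rw [hinv, ← h]
    simp only [Matrix.mul_assoc]
  rw [this, Jmat_eq, mul_diagonal, mul_diagonal_mul_conjTranspose_apply_self]
  push_cast
  ring

lemma setOf_diagonal_conj_eq (hp : 1 ≤ p) (d : Fin (p + q) → ℝ) :
    { v : Fin (p + q) → ℝ |
      ∃ g ∈ SUpq p q, ∀ k : Fin (p + q),
        (g * Matrix.diagonal (fun i => (d i : ℂ)) * g⁻¹) k k = (v k : ℂ) } =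
      diagonalImage p q d := by
  ext v
  constructor
  · rintro ⟨g, ⟨-, hg⟩, hv⟩
    refine ⟨g, (mul_Jmat_mul_conjTranspose_iff g).2 hg, fun k => ?_⟩
    have := hv k
    rw [conj_diagonal_apply_self hg] at this
    exact_mod_cast this.symm
  · rintro ⟨g, hg, hv⟩
    have hdet : g.det * star g.det = 1 := by
      have h := congrArg det hg
      have hJ : (Jmat p q).det * (Jmat p q).det = 1 := by
        rw [← det_mul, Jmat_mul_self, det_one]
      rw [det_mul, det_mul, det_conjTranspose] at h
      linear_combination (Jmat p q).det * h + (1 - g.det * star g.det) * hJ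
    have hnorm : Complex.normSq (star g.det) = 1 := by
      have := congrArg Complex.normSq hdet
      simp only [map_mul, RCLike.star_def, Complex.normSq_conj, map_one] at this
      rw [RCLike.star_def, Complex.normSq_conj]
      nlinarith [Complex.normSq_nonneg g.det]
    set i₀ : Fin (p + q) := ⟨0, by omega⟩
    set u : Fin (p + q) → ℂ := Function.update 1 i₀ (star g.det) with hu
    have hun : ∀ i, Complex.normSq (u i) = 1 := by
      intro i
      by_cases h : i = i₀
      · rw [h, hu, Function.update_self, hnorm]
      · rw [hu, Function.update_of_ne h]; simp
    have hgu : g * diagonal u * Jmat p q * (g * diagonal u)ᴴ = Jmat p q := by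
      have : diagonal u * Jmat p q * (diagonal u)ᴴ = Jmat p q := by
        rw [Jmat_eq, diagonal_conjTranspose, diagonal_mul_diagonal, diagonal_mul_diagonal]
        congr 1
        ext i
        have := Complex.normSq_eq_conj_mul_self (z := u i)
        rw [hun] at this
        simp only [Pi.star_apply, RCLike.star_def]
        push_cast at this
        linear_combination -(blockSign p q i : ℂ) * this
      calc _ = g * (diagonal u * Jmat p q * (diagonal u)ᴴ) * gᴴ := by
            simp only [conjTranspose_mul, Matrix.mul_assoc]
        _ = _ := by rw [this, hg]
    have hgu' := (mul_Jmat_mul_conjTranspose_iff _).1 hgu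
    refine ⟨g * diagonal u, ⟨?_, hgu'⟩, fun k => ?_⟩
    · rw [det_mul, det_diagonal, hu, Finset.prod_update_of_mem (Finset.mem_univ _)]
      simpa using hdet
    · rw [conj_diagonal_apply_self hgu', hv k]
      simp [mul_diagonal, hun]

end Orbit

section Cone

variable {p q : ℕ}

lemma mem_coneC {c : Fin (p + q) → ℝ} (hc₁ : ∀ i : Fin p, 0 ≤ c (Fin.castAdd q i))
    (hc₂ : ∀ j : Fin q, c (Fin.natAdd p j) ≤ 0) (hc : ∑ i, c i = 0) : c ∈ coneC p q := by
  set T := ∑ i : Fin p, c (Fin.castAdd q i) with hT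
  have hT0 : 0 ≤ T := Finset.sum_nonneg fun i _ => hc₁ i
  have hT' : ∑ j : Fin q, -c (Fin.natAdd p j) = T := by
    rw [Fin.sum_univ_add] at hc
    rw [Finset.sum_neg_distrib]
    linarith
  refine ⟨fun i j => |c i| * |c j| / T, fun i j => by positivity, fun k => ?_⟩
  have key : ∀ k : Fin (p + q), (∑ i : Fin (p + q), ∑ j : Fin (p + q),
      if (i : ℕ) < p ∧ p ≤ (j : ℕ) then
        |c i| * |c j| / T * ((if k = i then 1 else 0) - (if k = j then 1 else 0)) else 0) =
      ∑ i : Fin p, ∑ j : Fin q, c (Fin.castAdd q i) * -c (Fin.natAdd p j) / T *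
        ((if k = Fin.castAdd q i then 1 else 0) - (if k = Fin.natAdd p j then 1 else 0)) := by
    intro k
    simp only [Fin.sum_univ_add, Fin.val_castAdd, Fin.val_natAdd, Fin.is_lt, true_and,
      not_le.2 (Fin.is_lt _), if_false, Finset.sum_const_zero, zero_add, Nat.le_add_right, if_true,
      Nat.not_lt.2 (Nat.le_add_right _ _), false_and, add_zero, abs_of_nonneg (hc₁ _),
      abs_of_nonpos (hc₂ _)]
  rw [key]
  refine Fin.addCases (fun a => ?_) (fun b => ?_) k
  · have hne : ∀ j : Fin q, Fin.castAdd q a ≠ Fin.natAdd p j := fun j h => by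
      have := congrArg Fin.val h
      simp at this
      omega
    have : (∑ i : Fin p, ∑ j : Fin q, c (Fin.castAdd q i) * -c (Fin.natAdd p j) / T *
        ((if Fin.castAdd q a = Fin.castAdd q i then 1 else 0) -
          (if Fin.castAdd q a = Fin.natAdd p j then 1 else 0))) = c (Fin.castAdd q a) * T / T := by
      rw [Finset.sum_eq_single a (fun i _ hi => by simp [hne, hi.symm]) (by simp), ← hT',
        Finset.mul_sum, Finset.sum_div]
      simp [hne]
    rw [this]
    rcases eq_or_ne T 0 with h | h
    · have := (Finset.sum_eq_zero_iff_of_nonneg fun i _ => hc₁ i).1 (hT.symm.trans h) a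
        (Finset.mem_univ a)
      simp [this]
    · field_simp
  · have hne : ∀ i : Fin p, Fin.natAdd p b ≠ Fin.castAdd q i := fun j h => by
      have := congrArg Fin.val h
      simp at this
      omega
    have : (∑ i : Fin p, ∑ j : Fin q, c (Fin.castAdd q i) * -c (Fin.natAdd p j) / T *
        ((if Fin.natAdd p b = Fin.castAdd q i then 1 else 0) -
          (if Fin.natAdd p b = Fin.natAdd p j then 1 else 0))) = T * c (Fin.natAdd p b) / T := by
      rw [Finset.sum_comm, Finset.sum_eq_single b (fun j _ hj => by simp [hne, hj.symm]) (by simp),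
        hT, Finset.sum_mul, Finset.sum_div]
      simp [hne, neg_div]
    rw [this]
    rcases eq_or_ne T 0 with h | h
    · have := (Finset.sum_eq_zero_iff_of_nonneg fun j _ => neg_nonneg.2 (hc₂ j)).1
        (hT'.trans h) b (Finset.mem_univ b)
      simp [neg_eq_zero.1 this]
    · field_simp

end Cone

section BlockPermutations

variable {p q : ℕ}

/-- The rearrangements of `d` under permutations preserving the two blocks. -/
def blockPermutations (p q : ℕ) (d : Fin (p + q) → ℝ) : Set (Fin (p + q) → ℝ) :=
  { w | ∃ σ : Equiv.Perm (Fin (p + q)), (∀ i : Fin (p + q), (σ i : ℕ) < p ↔ (i : ℕ) < p) ∧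
      w = fun i => d (σ i) }

lemma append_comp_perm_mem_blockPermutations (d : Fin (p + q) → ℝ) (σ : Equiv.Perm (Fin p))
    (τ : Equiv.Perm (Fin q)) :
    Fin.append ((d ∘ Fin.castAdd q) ∘ σ) ((d ∘ Fin.natAdd p) ∘ τ) ∈ blockPermutations p q d := by
  refine ⟨(finSumFinEquiv.symm.trans (Equiv.sumCongr σ τ)).trans finSumFinEquiv, fun i => ?_, ?_⟩
  · refine Fin.addCases (fun a => ?_) (fun b => ?_) i <;> simp
  · ext i
    refine Fin.addCases (fun a => ?_) (fun b => ?_) i <;> simp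

lemma convex_setOf_append_left_mem {K : Set (Fin (p + q) → ℝ)} (hK : Convex ℝ K) (z : Fin q → ℝ) :
    Convex ℝ {x : Fin p → ℝ | Fin.append x z ∈ K} := by
  intro x hx y hy a b ha hb hab
  have : Fin.append (a • x + b • y) z = a • Fin.append x z + b • Fin.append y z := by
    ext i
    refine Fin.addCases (fun _ => ?_) (fun _ => ?_) i <;> simp [← add_mul, hab]
  rw [Set.mem_ofPred_eq, this]
  exact hK hx hy ha hb hab

lemma convex_setOf_append_right_mem {K : Set (Fin (p + q) → ℝ)} (hK : Convex ℝ K) (z : Fin p → ℝ) :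
    Convex ℝ {x : Fin q → ℝ | Fin.append z x ∈ K} := by
  intro x hx y hy a b ha hb hab
  have : Fin.append z (a • x + b • y) = a • Fin.append z x + b • Fin.append z y := by
    ext i
    refine Fin.addCases (fun _ => ?_) (fun _ => ?_) i <;> simp [← add_mul, hab]
  rw [Set.mem_ofPred_eq, this]
  exact hK hx hy ha hb hab

lemma append_mem_convexHull_blockPermutations {d : Fin (p + q) → ℝ} {x : Fin p → ℝ} {y : Fin q → ℝ}
    (hx : x ∈ convexHull ℝ (Set.range fun σ : Equiv.Perm (Fin p) => (d ∘ Fin.castAdd q) ∘ σ))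
    (hy : y ∈ convexHull ℝ (Set.range fun σ : Equiv.Perm (Fin q) => (d ∘ Fin.natAdd p) ∘ σ)) :
    Fin.append x y ∈ convexHull ℝ (blockPermutations p q d) := by
  have hK := convex_convexHull ℝ (blockPermutations p q d)
  refine convexHull_min ?_ (convex_setOf_append_left_mem hK y) hx
  rintro _ ⟨σ, rfl⟩
  refine convexHull_min ?_ (convex_setOf_append_right_mem hK _) hy
  rintro _ ⟨τ, rfl⟩
  exact subset_convexHull ℝ _ (append_comp_perm_mem_blockPermutations d σ τ)

lemma comp_mem_convexHull_of_blockPermutations {m : ℕ} (e : Fin m ↪ Fin (p + q))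
    {d y : Fin (p + q) → ℝ} (he : ∀ σ : Equiv.Perm (Fin (p + q)),
      (∀ i : Fin (p + q), (σ i : ℕ) < p ↔ (i : ℕ) < p) → ∀ i, ∃ j, σ (e i) = e j)
    (hy : y ∈ convexHull ℝ (blockPermutations p q d)) :
    y ∘ e ∈ convexHull ℝ (Set.range fun σ : Equiv.Perm (Fin m) => (d ∘ e) ∘ σ) := by
  refine convexHull_min ?_
    ((convex_convexHull ℝ _).linear_preimage (LinearMap.funLeft ℝ ℝ e)) hy
  rintro _ ⟨σ, hσ, rfl⟩
  choose f hf using he σ hσ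
  have hinj : Function.Injective f := fun i j h => by
    have := (hf i).trans ((congrArg e h).trans (hf j).symm)
    exact e.injective (σ.injective this)
  refine subset_convexHull ℝ _ ⟨Equiv.ofBijective f (Finite.injective_iff_bijective.1 hinj), ?_⟩
  ext i
  simp [LinearMap.funLeft_apply, hf]

lemma comp_castAdd_mem_convexHull {d y : Fin (p + q) → ℝ}
    (hy : y ∈ convexHull ℝ (blockPermutations p q d)) :
    y ∘ Fin.castAdd q ∈
      convexHull ℝ (Set.range fun σ : Equiv.Perm (Fin p) => (d ∘ Fin.castAdd q) ∘ σ) :=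
  comp_mem_convexHull_of_blockPermutations ⟨Fin.castAdd q, Fin.castAdd_injective p q⟩
    (fun σ hσ i => ⟨⟨σ (Fin.castAdd q i), (hσ _).2 i.is_lt⟩, rfl⟩) hy

lemma comp_natAdd_mem_convexHull {d y : Fin (p + q) → ℝ}
    (hy : y ∈ convexHull ℝ (blockPermutations p q d)) :
    y ∘ Fin.natAdd p ∈
      convexHull ℝ (Set.range fun σ : Equiv.Perm (Fin q) => (d ∘ Fin.natAdd p) ∘ σ) := by
  refine comp_mem_convexHull_of_blockPermutations ⟨Fin.natAdd p, Fin.natAdd_injective q p⟩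
    (fun σ hσ i => ?_) hy
  have h := (hσ (Fin.natAdd p i)).not
  simp only [Fin.val_natAdd, not_lt, Nat.le_add_right, iff_true] at h
  exact ⟨⟨σ (Fin.natAdd p i) - p, by omega⟩, Fin.ext (by simp; omega)⟩

/-- A set that is transfer-closed within each block contains, with `d`, the convex hull of all
block-preserving rearrangements of `d`. -/
lemma convexHull_blockPermutations_subset {S : Set (Fin (p + q) → ℝ)} {d : Fin (p + q) → ℝ}
    (hd : d ∈ S)
    (hS₁ : ∀ x ∈ S, ∀ (k l : Fin p) (δ : ℝ), 0 ≤ δ → x (Fin.castAdd q k) + δ ≤ x (Fin.castAdd q l) →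
      x + δ • (Pi.single (Fin.castAdd q k) (1 : ℝ) - Pi.single (Fin.castAdd q l) (1 : ℝ)) ∈ S)
    (hS₂ : ∀ x ∈ S, ∀ (k l : Fin q) (δ : ℝ), 0 ≤ δ → x (Fin.natAdd p k) + δ ≤ x (Fin.natAdd p l) →
      x + δ • (Pi.single (Fin.natAdd p k) (1 : ℝ) - Pi.single (Fin.natAdd p l) (1 : ℝ)) ∈ S) :
    convexHull ℝ (blockPermutations p q d) ⊆ S := by
  intro y hy
  have hne : ∀ (i : Fin p) (j : Fin q), Fin.castAdd q i ≠ Fin.natAdd p j := fun i j h => by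
    have := congrArg Fin.val h
    simp at this
    omega
  have happ : ∀ z : Fin (p + q) → ℝ, Fin.append (z ∘ Fin.castAdd q) (z ∘ Fin.natAdd p) = z :=
    fun z => by
      ext i
      refine Fin.addCases (fun _ => ?_) (fun _ => ?_) i <;> simp
  have h₁ : Fin.append (y ∘ Fin.castAdd q) (d ∘ Fin.natAdd p) ∈ S := by
    refine TransferClosed.mem_of_mem_convexHull
      (S := {x | Fin.append x (d ∘ Fin.natAdd p) ∈ S}) ?_ ?_ (comp_castAdd_mem_convexHull hy)
    · intro x hx k l δ hδ h
      rw [Set.mem_ofPred_eq]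
      convert hS₁ _ hx k l δ hδ (by simpa using h) using 1
      ext i
      refine Fin.addCases (fun _ => ?_) (fun _ => ?_) i <;>
        simp [Pi.single_apply, (hne _ _).symm]
    · rwa [Set.mem_ofPred_eq, happ d]
  rw [← happ y]
  refine TransferClosed.mem_of_mem_convexHull
    (S := {x | Fin.append (y ∘ Fin.castAdd q) x ∈ S}) ?_ h₁ (comp_natAdd_mem_convexHull hy)
  intro x hx k l δ hδ h
  rw [Set.mem_ofPred_eq]
  convert hS₂ _ hx k l δ hδ (by simpa using h) using 1
  ext i
  refine Fin.addCases (fun _ => ?_) (fun _ => ?_) i <;> simp [Pi.single_apply, hne]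

end BlockPermutations

section RowForm

variable {ι : Type*} [Fintype ι]

/-- The sesquilinear form `∑ xₘ wₘ conj(yₘ)`. -/
def rowForm (w : ι → ℝ) (x y : ι → ℂ) : ℂ := ∑ m, x m * w m * star (y m)

variable (w : ι → ℝ) (x y z : ι → ℂ) (a : ℂ)

lemma rowForm_add_left : rowForm w (x + y) z = rowForm w x z + rowForm w y z := by
  simp [rowForm, add_mul, Finset.sum_add_distrib]

lemma rowForm_add_right : rowForm w x (y + z) = rowForm w x y + rowForm w x z := by
  simp [rowForm, mul_add, Finset.sum_add_distrib]

lemma rowForm_smul_left : rowForm w (a • x) y = a * rowForm w x y := by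
  simp [rowForm, Finset.mul_sum, mul_assoc]

lemma rowForm_smul_right : rowForm w x (a • y) = star a * rowForm w x y := by
  simp only [rowForm, Finset.mul_sum, Pi.smul_apply, smul_eq_mul, star_mul']
  exact Finset.sum_congr rfl fun _ _ => by ring

lemma star_rowForm : star (rowForm w x y) = rowForm w y x := by
  simp only [rowForm, star_sum, star_mul', star_star]
  exact Finset.sum_congr rfl fun _ _ => by simp; ring

lemma rowForm_self : rowForm w x x = ((∑ m, Complex.normSq (x m) * w m : ℝ) : ℂ) := by
  push_cast
  refine Finset.sum_congr rfl fun m _ => ?_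
  rw [Complex.normSq_eq_conj_mul_self, RCLike.star_def]
  ring

end RowForm

section Rotation

variable {p q : ℕ} {g : Matrix (Fin (p + q)) (Fin (p + q)) ℂ}

lemma mul_Jmat_mul_conjTranspose_iff_rowForm :
    g * Jmat p q * gᴴ = Jmat p q ↔ ∀ i j, rowForm (blockSign p q) (g i) (g j) =
      if i = j then (blockSign p q i : ℂ) else 0 := by
  have h : ∀ i j, (g * Jmat p q * gᴴ) i j = rowForm (blockSign p q) (g i) (g j) := by
    intro i j
    rw [Jmat_eq, Matrix.mul_apply]
    simp only [mul_diagonal, conjTranspose_apply, rowForm]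
  have hJ : ∀ i j, Jmat p q i j = if i = j then (blockSign p q i : ℂ) else 0 := fun i j => by
    rw [Jmat_eq, diagonal_apply]
  exact ⟨fun hg i j => by rw [← h, hg, hJ], fun H => by ext i j; rw [h, H, hJ]⟩

/-- There is a unimodular `u` such that `conj(u) z` is purely imaginary. -/
lemma exists_star_mul_add_eq_zero (z : ℂ) :
    ∃ u : ℂ, u * star u = 1 ∧ star u * z + u * star z = 0 := by
  rcases eq_or_ne z 0 with rfl | hz
  · exact ⟨1, by simp, by simp⟩
  have hn : (‖z‖ : ℂ) ≠ 0 := by simpa using hz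
  have hzz : z * star z = (‖z‖ : ℂ) ^ 2 := by
    rw [RCLike.star_def, Complex.mul_conj, Complex.normSq_eq_norm_sq]
    push_cast
    rfl
  refine ⟨Complex.I * z / ‖z‖, ?_, ?_⟩
  · simp only [RCLike.star_def, map_div₀, map_mul, Complex.conj_I, Complex.conj_ofReal] at hzz ⊢
    field_simp
    linear_combination hzz - (z * (starRingEnd ℂ) z) * Complex.I_mul_I
  · simp only [RCLike.star_def, map_div₀, map_mul, Complex.conj_I, Complex.conj_ofReal]
    field_simp
    ring

lemma diagonalImage_add_smul_mem {d v : Fin (p + q) → ℝ} (hv : v ∈ diagonalImage p q d)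
    {k l : Fin (p + q)} (hkl : k ≠ l) {τ : ℝ} (hτ : τ ≤ 1)
    (hτ' : 0 ≤ blockSign p q k * blockSign p q l * τ) :
    v + (τ * (v l - v k)) • (Pi.single k (1 : ℝ) - Pi.single l (1 : ℝ)) ∈ diagonalImage p q d := by
  obtain ⟨g, hg, hv⟩ := hv
  set w : Fin (p + q) → ℝ := fun m => blockSign p q m * d m with hw
  have hrow := mul_Jmat_mul_conjTranspose_iff_rowForm.1 hg
  have hd : ∀ i, rowForm w (g i) (g i) = (blockSign p q i : ℂ) * v i := by
    intro i
    rw [rowForm_self, hv i]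
    have := blockSign_mul_self i
    push_cast
    rw [← mul_assoc]
    norm_cast
    rw [this, one_mul]
  obtain ⟨u, hu, huz⟩ := exists_star_mul_add_eq_zero (rowForm w (g k) (g l))
  have huz' : star u * rowForm w (g k) (g l) + u * rowForm w (g l) (g k) = 0 := by
    rwa [star_rowForm] at huz
  set η := blockSign p q k * blockSign p q l with hη
  obtain ⟨c, hc⟩ : ∃ c : ℝ, c * c = 1 - τ := ⟨√(1 - τ), Real.mul_self_sqrt (by linarith)⟩
  obtain ⟨s, hs⟩ : ∃ s : ℝ, s * s = η * τ := ⟨√(η * τ), Real.mul_self_sqrt hτ'⟩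
  have hk := blockSign_mul_self k
  have hl := blockSign_mul_self l
  have hcC : (c : ℂ) * c = 1 - τ := by exact_mod_cast hc
  have hsC : (s : ℂ) * s = blockSign p q k * blockSign p q l * τ := by exact_mod_cast hs
  have hkC : (blockSign p q k : ℂ) * blockSign p q k = 1 := by exact_mod_cast hk
  have hlC : (blockSign p q l : ℂ) * blockSign p q l = 1 := by exact_mod_cast hl
  set a : Fin (p + q) → ℂ := (c : ℂ) • g k + (u * s) • g l with ha
  set b : Fin (p + q) → ℂ := (-(η : ℂ) * star u * s) • g k + (c : ℂ) • g l with hb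
  set g' : Matrix (Fin (p + q)) (Fin (p + q)) ℂ :=
    Matrix.of fun i => if i = k then a else if i = l then b else g i with hg'
  have hgk : g' k = a := funext fun j => by simp [hg']
  have hgl : g' l = b := funext fun j => by simp [hg', hkl.symm]
  have hgi : ∀ i, i ≠ k → i ≠ l → g' i = g i := fun i h1 h2 => funext fun j => by
    simp [hg', h1, h2]
  have expand : ∀ (w : Fin (p + q) → ℝ) (α β γ δ : ℂ) (x y : Fin (p + q) → ℂ),
      rowForm w (α • x + β • y) (γ • x + δ • y) = α * star γ * rowForm w x x +
        α * star δ * rowForm w x y + β * star γ * rowForm w y x + β * star δ * rowForm w y y := by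
    intro w α β γ δ x y
    simp only [rowForm_add_left, rowForm_add_right, rowForm_smul_left, rowForm_smul_right]
    ring
  have hηC : (η : ℂ) = blockSign p q k * blockSign p q l := by rw [hη]; push_cast; rfl
  set K : ℂ := (blockSign p q k : ℂ)
  set L : ℂ := (blockSign p q l : ℂ)
  have hsr : ∀ r : ℝ, star (r : ℂ) = r := fun r => Complex.conj_ofReal r
  have haa : rowForm (blockSign p q) a a = blockSign p q k := by
    rw [ha, expand]
    simp only [hrow, hkl, hkl.symm, if_true, if_false, star_mul', hsr]
    linear_combination K * hcC + s * s * L * hu + L * hsC + K * τ * hlC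
  have hab : rowForm (blockSign p q) a b = 0 := by
    rw [ha, hb, expand]
    simp only [hrow, hkl, hkl.symm, if_true, if_false, star_mul', star_neg, star_star, hsr]
    rw [hηC]
    linear_combination -(u * s * c * L) * hkC
  have hbb : rowForm (blockSign p q) b b = blockSign p q l := by
    rw [hb, expand]
    simp only [hrow, hkl, hkl.symm, if_true, if_false, star_mul', star_neg, star_star, hsr]
    rw [hηC]
    linear_combination L * hcC + (K * L) ^ 2 * s * s * K * hu + (K * L) ^ 2 * K * hsC +
      τ * L * (L ^ 2 * (K ^ 2 + 1) * hkC + hlC)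
  have hba : rowForm (blockSign p q) b a = 0 := by rw [← star_rowForm, hab, star_zero]
  have haw : rowForm w a a = blockSign p q k * ((1 - τ) * v k + τ * v l) := by
    rw [ha, expand]
    simp only [hd, star_mul', hsr]
    linear_combination K * v k * hcC + c * s * huz' + s * s * L * v l * hu + L * v l * hsC +
      K * τ * v l * hlC
  have hbw : rowForm w b b = blockSign p q l * (τ * v k + (1 - τ) * v l) := by
    rw [hb, expand]
    simp only [hd, star_mul', star_neg, star_star, hsr]
    rw [hηC]
    linear_combination L * v l * hcC - K * L * s * c * huz' +
      v k * ((K * L) ^ 2 * s * s * K * hu + (K * L) ^ 2 * K * hsC +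
      τ * L * (L ^ 2 * (K ^ 2 + 1) * hkC + hlC))
  refine ⟨g', mul_Jmat_mul_conjTranspose_iff_rowForm.2 fun i j => ?_, fun i => ?_⟩
  · have hai : ∀ i, i ≠ k → i ≠ l → rowForm (blockSign p q) a (g i) = 0 := fun i h1 h2 => by
      rw [ha, rowForm_add_left, rowForm_smul_left, rowForm_smul_left, hrow, hrow,
        if_neg h1.symm, if_neg h2.symm, mul_zero, mul_zero, add_zero]
    have hbi : ∀ i, i ≠ k → i ≠ l → rowForm (blockSign p q) b (g i) = 0 := fun i h1 h2 => by
      rw [hb, rowForm_add_left, rowForm_smul_left, rowForm_smul_left, hrow, hrow,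
        if_neg h1.symm, if_neg h2.symm, mul_zero, mul_zero, add_zero]
    have hia : ∀ i, i ≠ k → i ≠ l → rowForm (blockSign p q) (g i) a = 0 := fun i h1 h2 => by
      rw [← star_rowForm, hai i h1 h2, star_zero]
    have hib : ∀ i, i ≠ k → i ≠ l → rowForm (blockSign p q) (g i) b = 0 := fun i h1 h2 => by
      rw [← star_rowForm, hbi i h1 h2, star_zero]
    rcases eq_or_ne i k with rfl | hik
    · rcases eq_or_ne j i with rfl | hji
      · rw [hgk, haa, if_pos rfl]
      rcases eq_or_ne j l with rfl | hjl
      · rw [hgk, hgl, hab, if_neg hkl]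
      · rw [hgk, hgi j hji hjl, hai j hji hjl, if_neg hji.symm]
    rcases eq_or_ne i l with rfl | hil
    · rcases eq_or_ne j i with rfl | hji
      · rw [hgl, hbb, if_pos rfl]
      rcases eq_or_ne j k with rfl | hjk
      · rw [hgk, hgl, hba, if_neg hkl.symm]
      · rw [hgl, hgi j hjk hji, hbi j hjk hji, if_neg hji.symm]
    rw [hgi i hik hil]
    rcases eq_or_ne j k with rfl | hjk
    · rw [hgk, hia i hik hil, if_neg hik]
    rcases eq_or_ne j l with rfl | hjl
    · rw [hgl, hib i hik hil, if_neg hil]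
    · rw [hgi j hjk hjl, hrow]
  · have key : (blockSign p q i : ℂ) * rowForm w (g' i) (g' i) =
        ((v i + τ * (v l - v k) * ((Pi.single k 1 : Fin (p + q) → ℝ) i -
          (Pi.single l 1 : Fin (p + q) → ℝ) i) : ℝ) : ℂ) := by
      rcases eq_or_ne i k with rfl | h1
      · rw [hgk, haw, ← mul_assoc, hkC]
        simp [hkl]
        ring
      rcases eq_or_ne i l with rfl | h2
      · rw [hgl, hbw, ← mul_assoc, hlC]
        simp [hkl.symm]
        ring
      · rw [hgi i h1 h2, hd, ← mul_assoc]
        have := blockSign_mul_self i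
        norm_cast
        simp [h1, h2, this]
    rw [rowForm_self] at key
    exact_mod_cast key.symm

end Rotation

section Image

variable {p q : ℕ}

lemma sum_normSq_mul_blockSign {g : Matrix (Fin (p + q)) (Fin (p + q)) ℂ}
    (hg : g * Jmat p q * gᴴ = Jmat p q) (k : Fin (p + q)) :
    ∑ m, Complex.normSq (g k m) * blockSign p q m = blockSign p q k := by
  have := mul_Jmat_mul_conjTranspose_iff_rowForm.1 hg k k
  rw [rowForm_self, if_pos rfl] at this
  exact_mod_cast this

lemma conjTranspose_mul_Jmat_mul {g : Matrix (Fin (p + q)) (Fin (p + q)) ℂ}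
    (hg : g * Jmat p q * gᴴ = Jmat p q) : gᴴ * Jmat p q * gᴴᴴ = Jmat p q := by
  rw [conjTranspose_conjTranspose]
  exact (mul_Jmat_mul_conjTranspose_iff g).1 hg

lemma sum_eq_of_mem_diagonalImage {d v : Fin (p + q) → ℝ} (hv : v ∈ diagonalImage p q d) :
    ∑ k, v k = ∑ k, d k := by
  obtain ⟨g, hg, hv⟩ := hv
  have hcol : ∀ m, ∑ k, Complex.normSq (g k m) * blockSign p q k = blockSign p q m := fun m => by
    simpa [conjTranspose_apply, Complex.normSq_conj] using
      sum_normSq_mul_blockSign (conjTranspose_mul_Jmat_mul hg) m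
  calc ∑ k, v k = ∑ m, (∑ k, Complex.normSq (g k m) * blockSign p q k) *
        (blockSign p q m * d m) := by
        simp only [hv, Finset.mul_sum, Finset.sum_mul]
        rw [Finset.sum_comm]
        exact Finset.sum_congr rfl fun _ _ => Finset.sum_congr rfl fun _ _ => by ring
    _ = ∑ m, d m := Finset.sum_congr rfl fun m _ => by
        rw [hcol, ← mul_assoc, blockSign_mul_self, one_mul]

lemma eq_add_blockSign_mul_sum {g : Matrix (Fin (p + q)) (Fin (p + q)) ℂ}
    (hg : g * Jmat p q * gᴴ = Jmat p q) (d : Fin (p + q) → ℝ) (μ : ℝ) (k : Fin (p + q)) :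
    blockSign p q k * ∑ m, Complex.normSq (g k m) * (blockSign p q m * d m) =
      μ + blockSign p q k * ∑ m, Complex.normSq (g k m) * (blockSign p q m * (d m - μ)) := by
  have : ∑ m, Complex.normSq (g k m) * (blockSign p q m * (d m - μ)) =
      ∑ m, Complex.normSq (g k m) * (blockSign p q m * d m) - μ * blockSign p q k := by
    rw [← sum_normSq_mul_blockSign hg k, Finset.mul_sum, ← Finset.sum_sub_distrib]
    exact Finset.sum_congr rfl fun _ _ => by ring
  rw [this]
  linear_combination μ * blockSign_mul_self k

lemma exists_between_blocks (hp : 1 ≤ p) (hq : 1 ≤ q) {d : Fin (p + q) → ℝ}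
    (hd : ∀ i j : Fin (p + q), (i : ℕ) < p → p ≤ (j : ℕ) → d j < d i) :
    ∃ μ, ∀ m, 0 < blockSign p q m * (d m - μ) := by
  have : Nonempty (Fin p) := ⟨⟨0, hp⟩⟩
  have : Nonempty (Fin q) := ⟨⟨0, hq⟩⟩
  obtain ⟨i, hi⟩ := Finite.exists_min fun i : Fin p => d (Fin.castAdd q i)
  obtain ⟨j, hj⟩ := Finite.exists_max fun j : Fin q => d (Fin.natAdd p j)
  obtain ⟨μ, hμ₁, hμ₂⟩ := exists_between (hd (Fin.castAdd q i) (Fin.natAdd p j) (by simp) (by simp))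
  refine ⟨μ, fun m => ?_⟩
  refine Fin.addCases (fun a => ?_) (fun b => ?_) m
  · have := hi a
    simp only [blockSign_castAdd]
    linarith
  · have := hj b
    simp only [blockSign_natAdd]
    linarith

/-- Every entry of the first block of a diagonal vector exceeds every entry of the second. -/
lemma blockSign_mul_sub_pos {d : Fin (p + q) → ℝ} {μ : ℝ}
    (hμ : ∀ m, 0 < blockSign p q m * (d m - μ)) {v : Fin (p + q) → ℝ}
    (hv : v ∈ diagonalImage p q d) (k : Fin (p + q)) : 0 < blockSign p q k * (v k - μ) := by
  obtain ⟨g, hg, hv⟩ := hv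
  rw [hv k, eq_add_blockSign_mul_sum hg d μ, add_sub_cancel_left, ← mul_assoc, blockSign_mul_self,
    one_mul]
  refine Finset.sum_pos' (fun m _ => mul_nonneg (Complex.normSq_nonneg _) (hμ m).le) ?_
  obtain ⟨m, -, hm⟩ := Finset.exists_ne_zero_of_sum_ne_zero
    (s := Finset.univ) (f := fun m => Complex.normSq (g k m) * blockSign p q m) (by
      rw [sum_normSq_mul_blockSign hg]
      exact left_ne_zero_of_mul_eq_one (blockSign_mul_self k))
  exact ⟨m, Finset.mem_univ m, mul_pos
    ((Complex.normSq_nonneg _).lt_of_ne' (left_ne_zero_of_mul hm)) (hμ m)⟩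

lemma mulVec_sub_const_of_mem_doublyStochastic {κ : Type*} [Fintype κ] [DecidableEq κ]
    {P : Matrix κ κ ℝ} (hP : P ∈ doublyStochastic ℝ κ) (x : κ → ℝ) (a μ : ℝ) (i : κ) :
    (P *ᵥ fun j => a * (x j - μ)) i = a * ((P *ᵥ x) i - μ) := by
  have h := sum_row_of_mem_doublyStochastic hP i
  simp only [mulVec, dotProduct]
  calc ∑ j, P i j * (a * (x j - μ)) = a * (∑ j, P i j * x j - μ * ∑ j, P i j) := by
        rw [Finset.mul_sum, ← Finset.sum_sub_distrib, Finset.mul_sum]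
        exact Finset.sum_congr rfl fun _ _ => by ring
    _ = _ := by rw [h, mul_one]

lemma exists_add_coneC_of_mem_diagonalImage {d : Fin (p + q) → ℝ} {μ : ℝ}
    (hμ : ∀ m, 0 < blockSign p q m * (d m - μ)) {v : Fin (p + q) → ℝ}
    (hv : v ∈ diagonalImage p q d) :
    ∃ y ∈ convexHull ℝ (blockPermutations p q d), ∃ c ∈ coneC p q, v = y + c := by
  have hsum := sum_eq_of_mem_diagonalImage hv
  obtain ⟨g, hg, hv⟩ := hv
  have hcol : ∀ a b, ∑ m, star (g m a) * blockSign p q m * g m b =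
      if a = b then (blockSign p q a : ℂ) else 0 := by
    intro a b
    have := mul_Jmat_mul_conjTranspose_iff_rowForm.1 (conjTranspose_mul_Jmat_mul hg) a b
    simpa only [rowForm, conjTranspose_apply, star_star] using this
  have hv' := fun k => (hv k).trans (eq_add_blockSign_mul_sum hg d μ k)
  have hnonneg : ∀ k m, 0 ≤ Complex.normSq (g k m) * (blockSign p q m * (d m - μ)) := fun k m =>
    mul_nonneg (Complex.normSq_nonneg _) (hμ m).le
  obtain ⟨P, hP, hPle⟩ := exists_doublyStochastic_mulVec_le
    (g.submatrix (Fin.castAdd q) (Fin.castAdd q)) (g.submatrix (Fin.natAdd p) (Fin.castAdd q)) (by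
      ext a b
      have := hcol (Fin.castAdd q a) (Fin.castAdd q b)
      simp only [Fin.sum_univ_add, blockSign_castAdd, blockSign_natAdd, Fin.castAdd_inj] at this
      simp only [Matrix.mul_apply, Matrix.add_apply, Matrix.one_apply, conjTranspose_apply,
        submatrix_apply]
      push_cast at this
      simp only [mul_one, mul_neg, neg_mul, Finset.sum_neg_distrib] at this
      linear_combination this)
    (w := fun i => 1 * (d (Fin.castAdd q i) - μ))
    (fun i => by simpa using (hμ (Fin.castAdd q i)).le)
  obtain ⟨Q, hQ, hQle⟩ := exists_doublyStochastic_mulVec_le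
    (g.submatrix (Fin.natAdd p) (Fin.natAdd p)) (g.submatrix (Fin.castAdd q) (Fin.natAdd p)) (by
      ext a b
      have := hcol (Fin.natAdd p a) (Fin.natAdd p b)
      simp only [Fin.sum_univ_add, blockSign_castAdd, blockSign_natAdd, Fin.natAdd_inj] at this
      simp only [Matrix.mul_apply, Matrix.add_apply, Matrix.one_apply, conjTranspose_apply,
        submatrix_apply]
      push_cast at this
      simp only [mul_one, mul_neg, neg_mul, Finset.sum_neg_distrib] at this
      split_ifs at this ⊢ <;> linear_combination -this)
    (w := fun i => -1 * (d (Fin.natAdd p i) - μ))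
    (fun i => by simpa using (hμ (Fin.natAdd p i)).le)
  set y := Fin.append (P *ᵥ (d ∘ Fin.castAdd q)) (Q *ᵥ (d ∘ Fin.natAdd p)) with hy
  refine ⟨y, append_mem_convexHull_blockPermutations (mulVec_mem_convexHull_perm hP _)
    (mulVec_mem_convexHull_perm hQ _), v - y, mem_coneC (fun i => ?_) (fun j => ?_) ?_, by simp⟩
  · have h := (mulVec_sub_const_of_mem_doublyStochastic hP (d ∘ Fin.castAdd q) 1 μ i).symm.trans_le
      (hPle i)
    have h₂ := Finset.sum_nonneg fun m (_ : m ∈ Finset.univ) =>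
      hnonneg (Fin.castAdd q i) (Fin.natAdd p m)
    simp only [Pi.sub_apply, hy, Fin.append_left, hv' (Fin.castAdd q i), Fin.sum_univ_add,
      blockSign_castAdd, submatrix_apply] at h h₂ ⊢
    linarith
  · have h := (mulVec_sub_const_of_mem_doublyStochastic hQ (d ∘ Fin.natAdd p) (-1) μ j).symm.trans_le
      (hQle j)
    have h₂ := Finset.sum_nonneg fun m (_ : m ∈ Finset.univ) =>
      hnonneg (Fin.natAdd p j) (Fin.castAdd q m)
    simp only [Pi.sub_apply, hy, Fin.append_right, hv' (Fin.natAdd p j), Fin.sum_univ_add,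
      blockSign_natAdd, submatrix_apply] at h h₂ ⊢
    linarith
  · simp only [Pi.sub_apply, Finset.sum_sub_distrib, hsum]
    rw [Fin.sum_univ_add, Fin.sum_univ_add y]
    simp only [hy, Fin.append_left, Fin.append_right]
    rw [sum_mulVec_of_mem_doublyStochastic hP, sum_mulVec_of_mem_doublyStochastic hQ]
    simp

lemma diagonalImage_add_smul_mem_of_blockSign_eq {d v : Fin (p + q) → ℝ}
    (hv : v ∈ diagonalImage p q d) {k l : Fin (p + q)} (hkl : blockSign p q k = blockSign p q l)
    {δ : ℝ} (hδ : 0 ≤ δ) (hle : v k + δ ≤ v l) :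
    v + δ • (Pi.single k (1 : ℝ) - Pi.single l (1 : ℝ)) ∈ diagonalImage p q d := by
  rcases eq_or_ne k l with rfl | hne
  · simpa using hv
  rcases hδ.eq_or_lt with rfl | hδ'
  · simpa using hv
  have hpos : 0 < v l - v k := by linarith
  have := diagonalImage_add_smul_mem hv hne (τ := δ / (v l - v k))
    ((div_le_one hpos).2 (by linarith))
    (by rw [hkl, blockSign_mul_self, one_mul]; positivity)
  rwa [div_mul_cancel₀ _ hpos.ne'] at this

lemma diagonalImage_add_coneC_generator_mem {d : Fin (p + q) → ℝ} {μ : ℝ}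
    (hμ : ∀ m, 0 < blockSign p q m * (d m - μ)) {v : Fin (p + q) → ℝ}
    (hv : v ∈ diagonalImage p q d) {k l : Fin (p + q)} (hk : (k : ℕ) < p) (hl : p ≤ (l : ℕ))
    {t : ℝ} (ht : 0 ≤ t) :
    v + t • (Pi.single k (1 : ℝ) - Pi.single l (1 : ℝ)) ∈ diagonalImage p q d := by
  have hsk : blockSign p q k = 1 := if_pos hk
  have hsl : blockSign p q l = -1 := if_neg (not_lt.2 hl)
  have h₁ := blockSign_mul_sub_pos hμ hv k
  have h₂ := blockSign_mul_sub_pos hμ hv l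
  rw [hsk] at h₁
  rw [hsl] at h₂
  have hpos : 0 < v k - v l := by linarith
  have hτ : 0 ≤ t / (v k - v l) := by positivity
  have := diagonalImage_add_smul_mem hv (k := k) (l := l) (by rintro rfl; omega)
    (τ := -(t / (v k - v l))) (by linarith) (by rw [hsk, hsl]; linarith)
  rwa [show -(t / (v k - v l)) * (v l - v k) = t by field_simp; ring] at this

lemma diagonalImage_add_mem_of_mem_coneC {d : Fin (p + q) → ℝ} {μ : ℝ}
    (hμ : ∀ m, 0 < blockSign p q m * (d m - μ)) {v c : Fin (p + q) → ℝ}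
    (hv : v ∈ diagonalImage p q d) (hc : c ∈ coneC p q) : v + c ∈ diagonalImage p q d := by
  obtain ⟨t, ht, hc⟩ := hc
  set f : Fin (p + q) × Fin (p + q) → Fin (p + q) → ℝ := fun x =>
    if (x.1 : ℕ) < p ∧ p ≤ (x.2 : ℕ) then
      t x.1 x.2 • (Pi.single x.1 (1 : ℝ) - Pi.single x.2 (1 : ℝ)) else 0 with hf
  have hcf : c = ∑ x, f x := by
    ext k
    rw [hc k, Finset.sum_apply, Fintype.sum_prod_type]
    refine Finset.sum_congr rfl fun i _ => Finset.sum_congr rfl fun j _ => ?_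
    simp only [hf]
    split_ifs <;> simp_all
  have : ∀ s : Finset (Fin (p + q) × Fin (p + q)), v + ∑ x ∈ s, f x ∈ diagonalImage p q d := by
    intro s
    induction s using Finset.induction_on with
    | empty => simpa using hv
    | insert x s hx ih =>
      rw [Finset.sum_insert hx, add_comm (f x), ← add_assoc]
      by_cases h : (x.1 : ℕ) < p ∧ p ≤ (x.2 : ℕ)
      · simp only [hf, if_pos h] at ih ⊢
        exact diagonalImage_add_coneC_generator_mem hμ ih h.1 h.2 (ht _ _)
      · simp only [hf, if_neg h, add_zero] at ih ⊢
        exact ih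
  rw [hcf]
  exact this _

lemma self_mem_diagonalImage (d : Fin (p + q) → ℝ) : d ∈ diagonalImage p q d := by
  refine ⟨1, by simp, fun k => ?_⟩
  rw [Finset.sum_eq_single k (fun m _ hm => by simp [Matrix.one_apply_ne hm.symm]) (by simp)]
  simp [← mul_assoc, blockSign_mul_self]

end Image

/-- the set of diagonal vectors of the matrices `g Λ g⁻¹`, `g ∈ SU(p,q)`,
equals the Minkowski sum of the convex hull of the block-permuted diagonals of `Λ`
with the cone `C`. -/
theorem diagonal_image_of_admissible_orbit (p q : ℕ) (hp : 1 ≤ p) (hq : 1 ≤ q)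
    (d : Fin (p + q) → ℝ) (hd0 : ∑ i, d i = 0)
    (hd : ∀ i j : Fin (p + q), (i : ℕ) < p → p ≤ (j : ℕ) → d j < d i) :
    { v : Fin (p + q) → ℝ |
      ∃ g ∈ SUpq p q, ∀ k : Fin (p + q),
        (g * Matrix.diagonal (fun i => (d i : ℂ)) * g⁻¹) k k = (v k : ℂ) } =
    { z : Fin (p + q) → ℝ |
      ∃ y ∈ convexHull ℝ { w : Fin (p + q) → ℝ |
          ∃ σ : Equiv.Perm (Fin (p + q)),
            (∀ i : Fin (p + q), (σ i : ℕ) < p ↔ (i : ℕ) < p) ∧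
            w = fun i => d (σ i) },
        ∃ c ∈ coneC p q, z = y + c } := by
  rw [setOf_diagonal_conj_eq hp]
  obtain ⟨μ, hμ⟩ := exists_between_blocks hp hq hd
  ext z
  constructor
  · exact exists_add_coneC_of_mem_diagonalImage hμ
  · rintro ⟨y, hy, c, hc, rfl⟩
    refine diagonalImage_add_mem_of_mem_coneC hμ ?_ hc
    refine convexHull_blockPermutations_subset (self_mem_diagonalImage d) ?_ ?_ hy
    · exact fun x hx k l δ hδ h =>
        diagonalImage_add_smul_mem_of_blockSign_eq hx (by simp) hδ h
    · exact fun x hx k l δ hδ h =>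
        diagonalImage_add_smul_mem_of_blockSign_eq hx (by simp) hδ h
end
end

section
/- For any g, h ∈ SU(p,q), writing s(g Λ_A g⁻¹ + h Λ_B h⁻¹) = (λ₁,…,λ_p, μ₁,…,μ_q), the sum of the p largest eigenvalues satisfies λ₁ + … + λ_p ≥ (a₁ + … + a_p) + (b₁ + … + b_p). -/
open Matrix Polynomial

noncomputable section

/-- Two real families with the same multiset of values differ by a permutation. -/
theorem exists_perm_of_map_eq {ι α : Type*} [Fintype ι] [DecidableEq α] {y x : ι → α}
    (h : Finset.univ.val.map y = Finset.univ.val.map x) :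
    ∃ σ : Equiv.Perm ι, ∀ i, y (σ i) = x i := by
  have hcard (c : α) : Fintype.card {i // x i = c} = Fintype.card {i // y i = c} := by
    have := congrArg (Multiset.count c) h
    rw [Multiset.count_map, Multiset.count_map] at this
    simp only [Fintype.card_subtype, Finset.card, Finset.filter_val]
    simpa only [eq_comm] using this.symm
  refine ⟨Equiv.ofFiberEquiv (f := x) (g := y) fun c => Fintype.equivOfCardEq (hcard c),
    fun i => ?_⟩
  exact Equiv.ofFiberEquiv_map _ i

section Indefinite

variable {ι : Type*} [Fintype ι] [DecidableEq ι]

/-- The diagonal entries of `Kᴴ diag(f) K`. -/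
theorem conjTranspose_mul_diagonal_mul_apply_self (f : ι → ℝ) (K : Matrix ι ι ℂ) (i : ι) :
    (Kᴴ * diagonal (fun k => (f k : ℂ)) * K) i i =
      ((∑ k, f k * Complex.normSq (K k i) : ℝ) : ℂ) := by
  rw [Matrix.mul_apply]
  push_cast
  refine Finset.sum_congr rfl fun k _ => ?_
  rw [mul_diagonal, conjTranspose_apply, Complex.normSq_eq_conj_mul_self]
  simp only [RCLike.star_def]
  ring

/-- A form congruent to `diag(e)` cannot have more positive directions than `diag(e)`. -/
theorem card_pos_le_of_congr {d e : ι → ℝ} {W : Matrix ι ι ℂ}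
    (hW : Wᴴ * diagonal (fun k => (e k : ℂ)) * W = diagonal fun k => (d k : ℂ)) :
    (Finset.univ.filter fun i => 0 < d i).card ≤ (Finset.univ.filter fun i => 0 < e i).card := by
  let ext : ({i // 0 < d i} → ℂ) →ₗ[ℂ] (ι → ℂ) := Function.ExtendByZero.linearMap ℂ Subtype.val
  let f : ({i // 0 < d i} → ℂ) →ₗ[ℂ] ({k // 0 < e k} → ℂ) :=
    (LinearMap.funLeft ℂ ℂ Subtype.val) ∘ₗ W.mulVecLin ∘ₗ ext
  have hform (g : ι → ℝ) (v : ι → ℂ) : star v ⬝ᵥ (diagonal (fun k => (g k : ℂ)) *ᵥ v) =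
      ((∑ k, g k * Complex.normSq (v k) : ℝ) : ℂ) := by
    simp only [dotProduct, mulVec_diagonal, Pi.star_apply, RCLike.star_def]
    push_cast
    refine Finset.sum_congr rfl fun k _ => ?_
    rw [Complex.normSq_eq_conj_mul_self]
    ring
  have hf : Function.Injective f := by
    rw [← LinearMap.ker_eq_bot, LinearMap.ker_eq_bot']
    intro v hv
    set u := ext v
    have huv (i : {i // 0 < d i}) : u i = v i := Subtype.val_injective.extend_apply v _ i
    have hu0 (i : ι) (hi : ¬ 0 < d i) : u i = 0 :=
      Function.extend_apply' v _ i fun ⟨j, hj⟩ => hi (hj ▸ j.2)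
    have key : ∑ k, d k * Complex.normSq (u k) = ∑ k, e k * Complex.normSq ((W *ᵥ u) k) := by
      rw [← Complex.ofReal_inj, ← hform, ← hform, ← hW, star_mulVec, ← mulVec_mulVec,
        ← mulVec_mulVec, dotProduct_mulVec]
    have hnonpos : ∑ k, e k * Complex.normSq ((W *ᵥ u) k) ≤ 0 := by
      refine Finset.sum_nonpos fun k _ => ?_
      by_cases hk : 0 < e k
      · have : (W *ᵥ u) k = 0 := congrFun hv ⟨k, hk⟩
        simp [this]
      · exact mul_nonpos_of_nonpos_of_nonneg (not_lt.mp hk) (Complex.normSq_nonneg _)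
    have hterm : ∀ k ∈ Finset.univ, 0 ≤ d k * Complex.normSq (u k) := fun k _ => by
      by_cases hk : 0 < d k
      · exact mul_nonneg hk.le (Complex.normSq_nonneg _)
      · simp [hu0 k hk]
    have hzero := (Finset.sum_eq_zero_iff_of_nonneg hterm).mp
      (le_antisymm (key.trans_le hnonpos) (Finset.sum_nonneg hterm))
    funext i
    have := hzero i (Finset.mem_univ _)
    rw [huv, mul_eq_zero, Complex.normSq_eq_zero] at this
    exact this.resolve_left i.2.ne'
  have := LinearMap.finrank_le_finrank_of_injective hf
  simpa [Module.finrank_fintype_fun_eq_card, Fintype.card_subtype] using this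

open scoped ComplexOrder in
/-- If `J` is Hermitian and `H` positive definite, then `J H` is diagonalised by a basis that is
orthonormal for `H`. -/
theorem exists_diagonalization_mul_posDef {J H : Matrix ι ι ℂ} (hJ : J.IsHermitian)
    (hH : H.PosDef) :
    ∃ (W : Matrix ι ι ℂ) (E : ι → ℝ), Wᴴ * H * W = 1 ∧
      J * H * W = W * diagonal (fun i => (E i : ℂ)) := by
  open scoped MatrixOrder Matrix.Norms.L2Operator in
  obtain ⟨S, hS, rfl⟩ :=
    CStarAlgebra.isStrictlyPositive_iff_eq_star_mul_self.mp hH.isStrictlyPositive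
  rw [star_eq_conjTranspose]
  have hA : (S * J * Sᴴ).IsHermitian := isHermitian_mul_mul_conjTranspose S hJ
  have hdet : IsUnit S.det := (isUnit_iff_isUnit_det S).mp hS
  set V : Matrix ι ι ℂ := (hA.eigenvectorUnitary : Matrix ι ι ℂ)
  have hVV : Vᴴ * V = 1 := Unitary.coe_star_mul_self hA.eigenvectorUnitary
  have hAV : S * J * Sᴴ * V = V * diagonal (fun i => (hA.eigenvalues i : ℂ)) := by
    conv_lhs => rw [hA.spectral_theorem, Unitary.conjStarAlgAut_apply]
    rw [Matrix.mul_assoc]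
    erw [Unitary.coe_star_mul_self]
    rw [Matrix.mul_one]
    rfl
  have hSW : S * (S⁻¹ * V) = V := mul_nonsing_inv_cancel_left _ _ hdet
  refine ⟨S⁻¹ * V, hA.eigenvalues, ?_, ?_⟩
  · calc (S⁻¹ * V)ᴴ * (Sᴴ * S) * (S⁻¹ * V)
        = (S * (S⁻¹ * V))ᴴ * (S * (S⁻¹ * V)) := by
          rw [conjTranspose_mul S]; simp only [Matrix.mul_assoc]
      _ = 1 := by rw [hSW, hVV]
  · calc J * (Sᴴ * S) * (S⁻¹ * V) = J * Sᴴ * (S * (S⁻¹ * V)) := by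
          simp only [Matrix.mul_assoc]
      _ = S⁻¹ * (S * (J * Sᴴ * V)) := by
          rw [hSW, nonsing_inv_mul_cancel_left _ _ hdet]
      _ = S⁻¹ * V * diagonal (fun i => (hA.eigenvalues i : ℂ)) := by
          rw [Matrix.mul_assoc S⁻¹, ← hAV]; simp only [Matrix.mul_assoc]

/-- If `J` is an involution, then the conjugate transpose of a `J`-unitary is `J`-unitary. -/
theorem mul_mul_conjTranspose_eq_of_conjTranspose_mul_mul_eq {J K : Matrix ι ι ℂ} (hJ : J * J = 1)
    (hK : Kᴴ * J * K = J) : K * J * Kᴴ = J := by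
  have h1 : (J * Kᴴ * J) * K = 1 := by
    rw [Matrix.mul_assoc J, Matrix.mul_assoc J, hK, hJ]
  have h2 := mul_eq_one_comm.mp h1
  calc K * J * Kᴴ = K * (J * Kᴴ * J) * J := by
        simp only [Matrix.mul_assoc, hJ, Matrix.mul_one]
    _ = J := by rw [h2, Matrix.one_mul]

/-- For a `J`-unitary `K` and a diagonal matrix whose entries at the positive places are separated
by `c` from the others, the trace over the positive places can only grow under
`J diag(a) ↦ Kᴴ J diag(a) K`. -/
theorem sum_le_sum_conjTranspose_mul_mul {e a : ι → ℝ} {K : Matrix ι ι ℂ} {c : ℝ}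
    (he : ∀ i, e i = 1 ∨ e i = -1)
    (hK : Kᴴ * diagonal (fun k => (e k : ℂ)) * K = diagonal fun k => (e k : ℂ))
    (hc : ∀ k, 0 < e k * (a k - c)) :
    ∑ i ∈ Finset.univ.filter (fun i => 0 < e i), a i ≤
      ∑ i ∈ Finset.univ.filter (fun i => 0 < e i),
        ((Kᴴ * diagonal (fun k => ((e k * a k : ℝ) : ℂ)) * K) i i).re := by
  have hJ : diagonal (fun k => (e k : ℂ)) * diagonal (fun k => (e k : ℂ)) = 1 := by
    rw [diagonal_mul_diagonal, ← diagonal_one]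
    congr 1
    funext k
    rcases he k with h | h <;> simp [h]
  have hK' := mul_mul_conjTranspose_eq_of_conjTranspose_mul_mul_eq hJ hK
  have hcol (i : ι) : ∑ k, e k * Complex.normSq (K k i) = e i := by
    have := conjTranspose_mul_diagonal_mul_apply_self e K i
    rw [hK, diagonal_apply_eq] at this
    exact_mod_cast this.symm
  have hrow (k : ι) : ∑ i, e i * Complex.normSq (K k i) = e k := by
    have := conjTranspose_mul_diagonal_mul_apply_self e Kᴴ k
    rw [conjTranspose_conjTranspose, hK', diagonal_apply_eq] at this
    simp only [conjTranspose_apply, RCLike.star_def, Complex.normSq_conj] at this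
    exact_mod_cast this.symm
  simp only [conjTranspose_mul_diagonal_mul_apply_self, Complex.ofReal_re]
  set P := Finset.univ.filter fun i => 0 < e i
  have heP : ∀ i ∈ P, e i = 1 := fun i hi => by
    have := (Finset.mem_filter.mp hi).2
    rcases he i with h | h
    · exact h
    · linarith
  have heP' : ∀ i ∉ P, e i = -1 := fun i hi => by
    rcases he i with h | h
    · exact absurd (Finset.mem_filter.mpr ⟨Finset.mem_univ i, by rw [h]; exact one_pos⟩) hi
    · exact h
  have hone : ∀ k ∈ P, 1 ≤ ∑ i ∈ P, Complex.normSq (K k i) := fun k hk => by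
    have h1 := hrow k
    rw [heP k hk, ← Finset.sum_add_sum_compl P] at h1
    have h2 : ∑ i ∈ P, e i * Complex.normSq (K k i) = ∑ i ∈ P, Complex.normSq (K k i) :=
      Finset.sum_congr rfl fun i hi => by rw [heP i hi, one_mul]
    have h3 : ∑ i ∈ Pᶜ, e i * Complex.normSq (K k i) ≤ 0 :=
      Finset.sum_nonpos fun i hi => by
        rw [heP' i (Finset.mem_compl.mp hi)]
        linarith [Complex.normSq_nonneg (K k i)]
    linarith
  have hsplit : ∑ i ∈ P, ∑ k, e k * a k * Complex.normSq (K k i) =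
      ∑ k, e k * (a k - c) * ∑ i ∈ P, Complex.normSq (K k i) + ∑ i ∈ P, c := by
    simp only [Finset.mul_sum]
    rw [Finset.sum_comm (s := Finset.univ), ← Finset.sum_add_distrib]
    refine Finset.sum_congr rfl fun i hi => ?_
    have : c = c * ∑ k, e k * Complex.normSq (K k i) := by rw [hcol, heP i hi, mul_one]
    rw [Finset.mul_sum] at this
    refine Eq.trans ?_ (congrArg (_ + ·) this.symm)
    rw [← Finset.sum_add_distrib]
    exact Finset.sum_congr rfl fun k _ => by ring
  rw [hsplit, ← sub_le_iff_le_add, ← Finset.sum_sub_distrib]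
  calc ∑ k ∈ P, (a k - c) ≤ ∑ k ∈ P, e k * (a k - c) * ∑ i ∈ P, Complex.normSq (K k i) :=
        Finset.sum_le_sum fun k hk => by
          have := hc k
          rw [heP k hk, one_mul] at this ⊢
          exact le_mul_of_one_le_right this.le (hone k hk)
    _ ≤ ∑ k, e k * (a k - c) * ∑ i ∈ P, Complex.normSq (K k i) :=
        Finset.sum_le_sum_of_subset_of_nonneg (Finset.subset_univ _) fun k _ _ =>
          mul_nonneg (hc k).le (Finset.sum_nonneg fun i _ => Complex.normSq_nonneg _)

open scoped ComplexOrder in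
/-- A matrix `M` such that `J (M - c)` is positive definite, where `J = diag(e)`, and whose
ordered spectrum is `x`, is conjugate to `diag(x)` by a `J`-unitary. -/
theorem exists_pseudoUnitary_diagonalization {e x : ι → ℝ} {M : Matrix ι ι ℂ} {c : ℝ}
    (he : ∀ i, e i = 1 ∨ e i = -1)
    (hM : (diagonal (fun k => (e k : ℂ)) * M - (c : ℂ) • diagonal (fun k => (e k : ℂ))).PosDef)
    (hx : M.charpoly = ∏ i, (X - C (x i : ℂ)))
    (hsep : ∀ i j, 0 < e i → ¬ 0 < e j → x j < x i) :
    ∃ G : Matrix ι ι ℂ, Gᴴ * diagonal (fun k => (e k : ℂ)) * G = diagonal (fun k => (e k : ℂ)) ∧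
      M * G = G * diagonal (fun k => (x k : ℂ)) := by
  set J : Matrix ι ι ℂ := diagonal (fun k => (e k : ℂ)) with hJdef
  have hJJ : J * J = 1 := by
    rw [hJdef, diagonal_mul_diagonal, ← diagonal_one]
    congr 1
    funext k
    rcases he k with h | h <;> simp [h]
  have hJherm : J.IsHermitian := by
    rw [hJdef, IsHermitian, diagonal_conjTranspose]
    congr 1
    funext k
    simp
  obtain ⟨W, E, hWH, hWE⟩ := exists_diagonalization_mul_posDef hJherm hM
  set H := J * M - (c : ℂ) • J
  have hJH : J * H = M - (c : ℂ) • 1 := by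
    rw [Matrix.mul_sub, ← Matrix.mul_assoc, hJJ, Matrix.one_mul, Matrix.mul_smul, hJJ]
  have hdet : IsUnit W.det := by
    have := congrArg det hWH
    rw [det_mul, det_one] at this
    exact IsUnit.of_mul_eq_one_right _ this
  have hform : Wᴴ * J * W * diagonal (fun i => (E i : ℂ)) = 1 := by
    calc Wᴴ * J * W * diagonal (fun i => (E i : ℂ)) = Wᴴ * (J * J) * H * W := by
          rw [Matrix.mul_assoc (Wᴴ * J), ← hWE]; simp only [Matrix.mul_assoc]
      _ = 1 := by rw [hJJ, Matrix.mul_one, hWH]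
  have hE (i : ι) : E i ≠ 0 := fun h => by
    have := congrFun (congrFun hform i) i
    rw [mul_diagonal, h] at this
    simp at this
  have hWJ : Wᴴ * J * W = diagonal (fun i => ((E i)⁻¹ : ℂ)) := by
    have h1 : diagonal (fun i => (E i : ℂ)) * diagonal (fun i => ((E i)⁻¹ : ℂ)) = 1 := by
      rw [diagonal_mul_diagonal, ← diagonal_one]
      congr 1
      funext i
      exact mul_inv_cancel₀ (Complex.ofReal_ne_zero.mpr (hE i))
    calc Wᴴ * J * W = Wᴴ * J * W *
          (diagonal (fun i => (E i : ℂ)) * diagonal (fun i => ((E i)⁻¹ : ℂ))) := by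
          rw [h1, Matrix.mul_one]
      _ = _ := by rw [← Matrix.mul_assoc, hform, Matrix.one_mul]
  have hMW : M * W = W * diagonal (fun i => ((E i + c : ℝ) : ℂ)) := by
    have h1 : diagonal (fun i => ((E i + c : ℝ) : ℂ)) =
        diagonal (fun i => (E i : ℂ)) + (c : ℂ) • 1 := by
      ext i j
      by_cases hij : i = j
      · subst hij; simp
      · simp [hij]
    rw [h1, Matrix.mul_add, ← hWE, hJH, Matrix.sub_mul]
    simp
  have hchar : M.charpoly = ∏ i, (X - C ((E i + c : ℝ) : ℂ)) := by
    have h1 : M = W * (diagonal (fun i => ((E i + c : ℝ) : ℂ)) * W⁻¹) := by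
      rw [← Matrix.mul_assoc, ← hMW, mul_nonsing_inv_cancel_right _ _ hdet]
    rw [h1, charpoly_mul_comm, nonsing_inv_mul_cancel_right _ _ hdet, charpoly_diagonal]
  obtain ⟨σ, hσ⟩ : ∃ σ : Equiv.Perm ι, ∀ i, E (σ i) + c = x i := by
    refine exists_perm_of_map_eq (y := fun i => E i + c) ?_
    have h1 := congrArg roots (hchar.symm.trans hx)
    rw [Finset.prod_eq_multiset_prod, Finset.prod_eq_multiset_prod] at h1
    have h2 (f : ι → ℝ) : (Finset.univ.val.map fun i => X - C (f i : ℂ)) =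
        ((Finset.univ.val.map f).map Complex.ofReal).map fun a => X - C a := by
      simp [Multiset.map_map]
    rw [h2, h2, roots_multiset_prod_X_sub_C, roots_multiset_prod_X_sub_C] at h1
    exact Multiset.map_injective Complex.ofReal_injective h1
  set d : ι → ℝ := fun i => x i - c with hd
  have hdE (i : ι) : E (σ i) = d i := by rw [hd]; linarith [hσ i]
  have hd0 (i : ι) : d i ≠ 0 := hdE i ▸ hE _
  set W' := W.submatrix id σ
  have hWJ' : W'ᴴ * J * W' = diagonal (fun i => (((d i)⁻¹ : ℝ) : ℂ)) := by
    have : W'ᴴ * J * W' = (Wᴴ * J * W).submatrix σ σ := rfl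
    rw [this, hWJ, submatrix_diagonal_equiv]
    congr 1
    funext i
    simp [hdE]
  have hMW' : M * W' = W' * diagonal (fun i => (x i : ℂ)) := by
    have h1 : M * W' = (M * W).submatrix id σ := rfl
    ext i j
    rw [h1, hMW, submatrix_apply, mul_diagonal, mul_diagonal, hσ]
    rfl
  have hcardpos := card_pos_le_of_congr hWJ'
  have hcardneg : (Finset.univ.filter fun i => 0 < -(d i)⁻¹).card ≤
      (Finset.univ.filter fun i => 0 < -e i).card := by
    refine card_pos_le_of_congr (W := W') ?_
    have h1 (f : ι → ℝ) : diagonal (fun k => ((-f k : ℝ) : ℂ)) =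
        -diagonal (fun k => (f k : ℂ)) := by
      rw [diagonal_neg]
      congr 1
      funext k
      simp
    rw [h1, h1 fun k => (d k)⁻¹, Matrix.mul_neg, Matrix.neg_mul, ← hWJ']
  simp only [inv_pos, ← inv_neg] at hcardpos hcardneg
  have hneg (i : ι) (hi : ¬ 0 < e i) : d i < 0 := by
    by_contra hcon
    have hpos : 0 < d i := lt_of_le_of_ne (not_lt.mp hcon) (hd0 i).symm
    refine absurd hcardpos (not_le.mpr (Finset.card_lt_card ?_))
    refine Finset.ssubset_iff_subset_ne.mpr ⟨fun j hj => ?_, fun heq => ?_⟩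
    · have := hsep j i (Finset.mem_filter.mp hj).2 hi
      refine Finset.mem_filter.mpr ⟨Finset.mem_univ j, ?_⟩
      simp only [hd] at hpos ⊢
      linarith
    · have : i ∈ Finset.univ.filter fun i => 0 < e i :=
        heq ▸ Finset.mem_filter.mpr ⟨Finset.mem_univ i, hpos⟩
      exact hi (Finset.mem_filter.mp this).2
  have hpos (i : ι) (hi : 0 < e i) : 0 < d i := by
    by_contra hcon
    have hneg' : 0 < -d i := neg_pos.mpr (lt_of_le_of_ne (not_lt.mp hcon) (hd0 i))
    refine absurd hcardneg (not_le.mpr (Finset.card_lt_card ?_))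
    refine Finset.ssubset_iff_subset_ne.mpr ⟨fun j hj => ?_, fun heq => ?_⟩
    · have := hneg j (by linarith [(Finset.mem_filter.mp hj).2])
      exact Finset.mem_filter.mpr ⟨Finset.mem_univ j, by linarith⟩
    · have : i ∈ Finset.univ.filter fun i => 0 < -e i :=
        heq ▸ Finset.mem_filter.mpr ⟨Finset.mem_univ i, hneg'⟩
      linarith [(Finset.mem_filter.mp this).2]
  refine ⟨W' * diagonal (fun i => ((√|d i| : ℝ) : ℂ)), ?_, ?_⟩
  · have h1 : (diagonal (fun i => ((√|d i| : ℝ) : ℂ)))ᴴ = diagonal (fun i => ((√|d i| : ℝ) : ℂ)) := by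
      rw [diagonal_conjTranspose]
      congr 1
      funext k
      simp
    set R := diagonal (fun i => ((√|d i| : ℝ) : ℂ)) with hR
    calc (W' * R)ᴴ * J * (W' * R) = R * (W'ᴴ * J * W') * R := by
          rw [conjTranspose_mul, h1]; simp only [Matrix.mul_assoc]
      _ = J := by
          rw [hWJ', hR, diagonal_mul_diagonal, diagonal_mul_diagonal, hJdef]
          congr 1
          funext i
          rw [← Complex.ofReal_mul, ← Complex.ofReal_mul, mul_right_comm,
            Real.mul_self_sqrt (abs_nonneg _)]
          congr 1
          rcases he i with h | h
          · have hdi := hpos i (by rw [h]; exact one_pos)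
            rw [abs_of_pos hdi, h, mul_inv_cancel₀ (hd0 i)]
          · have hdi := hneg i (by rw [h]; norm_num)
            rw [abs_of_neg hdi, h, neg_mul, mul_inv_cancel₀ (hd0 i)]
  · rw [← Matrix.mul_assoc, hMW', Matrix.mul_assoc, Matrix.mul_assoc, diagonal_mul_diagonal,
      diagonal_mul_diagonal]
    simp only [mul_comm]

/-- If `K` is the inverse of a `J`-unitary `g`, then `K` is `J`-unitary and
`J g D g⁻¹ = Kᴴ J D K`. -/
theorem inv_pseudoUnitary {J g : Matrix ι ι ℂ} (hdet : IsUnit g.det) (hg : gᴴ * J * g = J) :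
    (g⁻¹)ᴴ * J * g⁻¹ = J ∧ ∀ D : Matrix ι ι ℂ, J * (g * D * g⁻¹) = (g⁻¹)ᴴ * (J * D) * g⁻¹ := by
  have h1 : (g⁻¹)ᴴ * J = J * g := by
    have h2 : (g⁻¹)ᴴ * gᴴ = 1 := by
      rw [← conjTranspose_mul, mul_nonsing_inv _ hdet, conjTranspose_one]
    calc (g⁻¹)ᴴ * J = (g⁻¹)ᴴ * (gᴴ * J * g) := by rw [hg]
      _ = (g⁻¹)ᴴ * gᴴ * J * g := by simp only [Matrix.mul_assoc]
      _ = J * g := by rw [h2, Matrix.one_mul]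
  refine ⟨by rw [h1, mul_nonsing_inv_cancel_right _ _ hdet], fun D => ?_⟩
  rw [← Matrix.mul_assoc (g⁻¹)ᴴ, h1]
  simp only [Matrix.mul_assoc]

omit [DecidableEq ι] in
/-- The product of `J`-unitaries is `J`-unitary. -/
theorem mul_pseudoUnitary {J K G : Matrix ι ι ℂ} (hK : Kᴴ * J * K = J) (hG : Gᴴ * J * G = J) :
    (K * G)ᴴ * J * (K * G) = J := by
  calc (K * G)ᴴ * J * (K * G) = Gᴴ * (Kᴴ * J * K) * G := by
        rw [conjTranspose_mul]; simp only [Matrix.mul_assoc]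
    _ = J := by rw [hK, hG]

open scoped ComplexOrder in
/-- If `J = diag(e)` and `c` separates the entries of `a` at the positive places from the others,
then `Kᴴ J diag(a) K - c J` is positive definite for every `J`-unitary `K`. -/
theorem posDef_conjTranspose_mul_mul_sub {e a : ι → ℝ} {K : Matrix ι ι ℂ} {c : ℝ}
    (hK : Kᴴ * diagonal (fun k => (e k : ℂ)) * K = diagonal (fun k => (e k : ℂ)))
    (hKu : IsUnit K) (hc : ∀ k, 0 < e k * (a k - c)) :
    (Kᴴ * diagonal (fun k => ((e k * a k : ℝ) : ℂ)) * K -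
      (c : ℂ) • diagonal (fun k => (e k : ℂ))).PosDef := by
  have h1 : Kᴴ * diagonal (fun k => ((e k * a k : ℝ) : ℂ)) * K -
      (c : ℂ) • diagonal (fun k => (e k : ℂ)) =
      Kᴴ * diagonal (fun k => ((e k * (a k - c) : ℝ) : ℂ)) * K := by
    have h2 : diagonal (fun k => ((e k * (a k - c) : ℝ) : ℂ)) =
        diagonal (fun k => ((e k * a k : ℝ) : ℂ)) - (c : ℂ) • diagonal (fun k => (e k : ℂ)) := by
      rw [← diagonal_smul, diagonal_sub]
      congr 1
      funext k
      simp only [Pi.smul_apply, smul_eq_mul]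
      push_cast
      ring
    rw [h2, Matrix.mul_sub, Matrix.sub_mul, Matrix.mul_smul, Matrix.smul_mul, hK]
  rw [h1]
  refine PosDef.conjTranspose_mul_mul_same
    (posDef_diagonal_iff.mpr fun k => Complex.zero_lt_real.mpr (hc k)) ?_
  exact mulVec_injective_of_isUnit hKu

end Indefinite

/-- for any `g, h ∈ SU(p,q)`, if `x = s(g Λ_A g⁻¹ + h Λ_B h⁻¹)` then the
sum of its first `p` entries (the `p` largest eigenvalues) is at least
`(a₁ + … + a_p) + (b₁ + … + b_p)`. -/
theorem sum_of_top_eigenvalues_ge (p q : ℕ) (hp : 1 ≤ p) (hq : 1 ≤ q)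
    (a b : Fin (p + q) → ℝ)
    (ha0 : ∑ i, a i = 0) (hb0 : ∑ i, b i = 0)
    (ha : ∀ i j : Fin (p + q), (i : ℕ) < p → p ≤ (j : ℕ) → a j < a i)
    (hb : ∀ i j : Fin (p + q), (i : ℕ) < p → p ≤ (j : ℕ) → b j < b i)
    (g h : Matrix (Fin (p + q)) (Fin (p + q)) ℂ)
    (hg : g ∈ SUpq p q) (hh : h ∈ SUpq p q)
    (x : Fin (p + q) → ℝ)
    (hx : IsOrderedSpectrum p q
      (g * Matrix.diagonal (fun i => (a i : ℂ)) * g⁻¹ +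
        h * Matrix.diagonal (fun i => (b i : ℂ)) * h⁻¹) x) :
    ∑ i ∈ Finset.univ.filter (fun i : Fin (p + q) => (i : ℕ) < p), (a i + b i) ≤
      ∑ i ∈ Finset.univ.filter (fun i : Fin (p + q) => (i : ℕ) < p), x i := by
  set e : Fin (p + q) → ℝ := fun i => if (i : ℕ) < p then 1 else -1 with he_def
  have he : ∀ i, e i = 1 ∨ e i = -1 := fun i => by
    by_cases h : (i : ℕ) < p <;> simp [he_def, h]
  have he_pos (i : Fin (p + q)) : (i : ℕ) < p ↔ 0 < e i := by
    by_cases h : (i : ℕ) < p <;> simp [he_def, h]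
  have hJ : Jmat p q = diagonal (fun k => (e k : ℂ)) := by
    rw [Jmat]
    congr 1
    funext k
    by_cases h : (k : ℕ) < p <;> simp [he_def, h]
  have hgap (a : Fin (p + q) → ℝ)
      (ha : ∀ i j : Fin (p + q), (i : ℕ) < p → p ≤ (j : ℕ) → a j < a i) :
      ∃ c : ℝ, ∀ k, 0 < e k * (a k - c) := by
    obtain ⟨c, hc1, hc2⟩ := Finset.exists_between'
      ((Finset.univ.filter fun j : Fin (p + q) => p ≤ (j : ℕ)).image a)
      ((Finset.univ.filter fun i : Fin (p + q) => (i : ℕ) < p).image a) (by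
        simp only [Finset.mem_image, Finset.mem_filter, Finset.mem_univ, true_and]
        rintro _ ⟨j, hj, rfl⟩ _ ⟨i, hi, rfl⟩
        exact ha i j hi hj)
    refine ⟨c, fun k => ?_⟩
    by_cases h : (k : ℕ) < p
    · have := hc2 (a k) (Finset.mem_image_of_mem a (by simpa using h))
      simp only [he_def, h, if_true]
      linarith
    · have := hc1 (a k) (Finset.mem_image_of_mem a (by simpa using h))
      simp only [he_def, h, if_false]
      linarith
  obtain ⟨ca, hca⟩ := hgap a ha
  obtain ⟨cb, hcb⟩ := hgap b hb
  obtain ⟨hgdet, hgJ⟩ := hg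
  obtain ⟨hhdet, hhJ⟩ := hh
  rw [hJ] at hgJ hhJ
  have hgu : IsUnit g.det := hgdet ▸ isUnit_one
  have hhu : IsUnit h.det := hhdet ▸ isUnit_one
  obtain ⟨hgK, hgD⟩ := inv_pseudoUnitary hgu hgJ
  obtain ⟨hhK, hhD⟩ := inv_pseudoUnitary hhu hhJ
  obtain ⟨-, hsep, hchar⟩ := hx
  have hJD (a : Fin (p + q) → ℝ) : diagonal (fun k => (e k : ℂ)) * diagonal (fun k => (a k : ℂ)) =
      diagonal (fun k => ((e k * a k : ℝ) : ℂ)) := by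
    rw [diagonal_mul_diagonal]
    simp only [Complex.ofReal_mul]
  open scoped ComplexOrder in
  have hM :=
    (posDef_conjTranspose_mul_mul_sub hgK
      (isUnit_nonsing_inv_iff.mpr ((isUnit_iff_isUnit_det g).mpr hgu)) hca).add
    (posDef_conjTranspose_mul_mul_sub hhK
      (isUnit_nonsing_inv_iff.mpr ((isUnit_iff_isUnit_det h).mpr hhu)) hcb)
  rw [← hJD, ← hJD, ← hgD, ← hhD, sub_add_sub_comm, ← Matrix.mul_add, ← add_smul,
    ← Complex.ofReal_add] at hM
  obtain ⟨G, hGJ, hMG⟩ := exists_pseudoUnitary_diagonalization he hM hchar fun i j hi hj =>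
    hsep i j ((he_pos i).mpr hi) (not_lt.mp fun hlt => hj ((he_pos j).mp hlt))
  have hA := sum_le_sum_conjTranspose_mul_mul he (mul_pseudoUnitary hgK hGJ) hca
  have hB := sum_le_sum_conjTranspose_mul_mul he (mul_pseudoUnitary hhK hGJ) hcb
  simp only [he_pos]
  rw [Finset.sum_add_distrib]
  refine (add_le_add hA hB).trans_eq ?_
  rw [← Finset.sum_add_distrib]
  refine Finset.sum_congr rfl fun i hi => ?_
  have hei : e i = 1 := (he i).resolve_right fun h => by
    linarith [(Finset.mem_filter.mp hi).2]
  have hsum : (g⁻¹ * G)ᴴ * diagonal (fun k => ((e k * a k : ℝ) : ℂ)) * (g⁻¹ * G) +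
      (h⁻¹ * G)ᴴ * diagonal (fun k => ((e k * b k : ℝ) : ℂ)) * (h⁻¹ * G) =
      diagonal (fun k => ((e k * x k : ℝ) : ℂ)) := by
    have h1 (K D : Matrix (Fin (p + q)) (Fin (p + q)) ℂ) :
        (K * G)ᴴ * D * (K * G) = Gᴴ * (Kᴴ * D * K) * G := by
      rw [conjTranspose_mul]; simp only [Matrix.mul_assoc]
    rw [h1, h1, ← hJD, ← hJD, ← hgD, ← hhD, ← Matrix.add_mul, ← Matrix.mul_add, ← Matrix.mul_add,
      ← Matrix.mul_assoc, Matrix.mul_assoc, hMG, ← Matrix.mul_assoc, hGJ, hJD]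
  rw [← Complex.add_re, ← Matrix.add_apply, hsum, diagonal_apply_eq, Complex.ofReal_re, hei, one_mul]
end
end
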